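/- arXiv:1611.02231 — 2 statements merged into one kernel-verified Lean document; each statement's English description precedes it below -/
import Mathlib

section
/- Let k be an integer with k ≥ 3, and let λ be an integer with λ ≥ k+2 such that every λ-edge-connected graph H admits a g-orientation for every mapping g : V(H) → Z_k with |E(H)| ≡ Σ_{v∈V(H)} g(v) (mod k). If a graph G contains λ−2 pairwise edge-disjoint spanning trees and f : V(G) → Z_k is a mapping with |E(G)| ≡ Σ_{v∈V(G)} f(v) (mod k), then G has an f-orientation. -/
/-- A finite loopless multigraph on vertex type `V` with edge type `E`:
each edge `e` is given by its two (distinct) endpoints `fst e` and `snd e`.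
Multiple edges are allowed, loops are not. -/
structure Multigraph (V : Type) (E : Type) where
  fst : E → V
  snd : E → V
  loopless : ∀ e, fst e ≠ snd e

namespace Multigraph

variable {V E : Type} (G : Multigraph V E)

/-- `u` and `v` are joined by some edge belonging to the edge set `F`. -/
def AdjOn (F : Set E) (u v : V) : Prop :=
  ∃ e ∈ F, (G.fst e = u ∧ G.snd e = v) ∨ (G.fst e = v ∧ G.snd e = u)

/-- The subgraph with vertex set `S` and edge set `F` is a connected spanning
subgraph of the induced subgraph of `G` on `S`: all edges of `F` have both
endpoints in `S`, and any two vertices of `S` are joined by a walk using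
edges of `F`. -/
def ConnectedWithin (S : Set V) (F : Set E) : Prop :=
  (∀ e ∈ F, G.fst e ∈ S ∧ G.snd e ∈ S) ∧
    ∀ u ∈ S, ∀ v ∈ S, Relation.ReflTransGen (G.AdjOn F) u v

/-- The spanning subgraph of `G` with edge set `F` is connected. -/
def ConnectedOn (F : Set E) : Prop := G.ConnectedWithin Set.univ F

/-- `G` is a connected graph. -/
def Connected : Prop := G.ConnectedOn Set.univ

/-- `F` is the edge set of a spanning tree of the induced subgraph of `G`
on `S`, i.e. a minimal edge set making `S` connected. -/
def IsSpanningTreeWithin (S : Set V) (F : Set E) : Prop :=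
  G.ConnectedWithin S F ∧ ∀ F' ⊆ F, G.ConnectedWithin S F' → F' = F

/-- `F` is the edge set of a spanning tree of `G`:
a minimal edge set making `G` connected. -/
def IsSpanningTree (F : Set E) : Prop := G.IsSpanningTreeWithin Set.univ F

/-- `G` contains `t` pairwise edge-disjoint spanning trees. -/
def HasEdgeDisjointSpanningTrees (t : ℕ) : Prop :=
  ∃ T : Fin t → Set E, (∀ i, G.IsSpanningTree (T i)) ∧
    ∀ i j, i ≠ j → Disjoint (T i) (T j)

/-- The edge cut determined by the vertex set `S`: all edges with exactly
one endpoint in `S`. -/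
def cutEdges (S : Set V) : Set E :=
  {e | (G.fst e ∈ S ∧ G.snd e ∉ S) ∨ (G.fst e ∉ S ∧ G.snd e ∈ S)}

/-- `G` is `n`-edge-connected: it is connected and every edge cut has at
least `n` edges. -/
def EdgeConnected (n : ℕ) : Prop :=
  G.Connected ∧
    ∀ S : Set V, S.Nonempty → S ≠ Set.univ → n ≤ (G.cutEdges S).ncard

/-- An orientation of `G` is a map `o : E → Bool`: `o e = true` means `e` is
directed from `fst e` to `snd e`, and `o e = false` means the reverse.
`tail o e` is the initial vertex of `e` under the orientation `o`. -/
def tail (o : E → Bool) (e : E) : V := if o e then G.fst e else G.snd e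

/-- The terminal vertex of the edge `e` under the orientation `o`. -/
def head (o : E → Bool) (e : E) : V := if o e then G.snd e else G.fst e

/-- The number of edges belonging to `F` directed away from `v` by `o`. -/
noncomputable def outDegOn (F : Set E) (o : E → Bool) (v : V) : ℕ :=
  {e ∈ F | G.tail o e = v}.ncard

/-- The out-degree of `v` under the orientation `o`. -/
noncomputable def outDeg (o : E → Bool) (v : V) : ℕ := G.outDegOn Set.univ o v

/-- The in-degree of `v` under the orientation `o`. -/
noncomputable def inDeg (o : E → Bool) (v : V) : ℕ := {e | G.head o e = v}.ncard

/-- The degree of `v` in the spanning subgraph with edge set `F`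
(there are no loops, so each edge at `v` counts once). -/
noncomputable def degOn (F : Set E) (v : V) : ℕ := {e ∈ F | G.fst e = v ∨ G.snd e = v}.ncard

/-- `o` is an `f`-orientation of `G` (modulo `k`): the out-degree of every
vertex `v` is congruent to `f v` modulo `k`. -/
def IsModOrientation (k : ℕ) (f : V → ZMod k) (o : E → Bool) : Prop :=
  ∀ v, (G.outDeg o v : ZMod k) = f v

/-- `G` is `Z_3`-connected: for every `f : V → ZMod 3` with
`|E(G)| ≡ ∑ v, f v (mod 3)`, `G` has an `f`-orientation. -/
def Z3Connected [Fintype V] [Fintype E] : Prop :=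
  ∀ f : V → ZMod 3, (Nat.card E : ZMod 3) = ∑ v, f v →
    ∃ o : E → Bool, G.IsModOrientation 3 f o

/-- `G` is a simple graph: no two distinct edges have the same endpoints
(and there are no loops, by definition of `Multigraph`). -/
def IsSimple : Prop :=
  ∀ e e' : E, s(G.fst e, G.snd e) = s(G.fst e', G.snd e') → e = e'

/-- `G` admits a decomposition of its edge set into stars with `k` edges:
a partition of `E` into parts, each consisting of `k` edges sharing a
common center vertex. -/
def HasStarDecomposition (k : ℕ) : Prop :=
  ∃ P : Set (Set E), (∀ e : E, ∃! p, p ∈ P ∧ e ∈ p) ∧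
    ∀ p ∈ P, ∃ c : V, (∀ e ∈ p, G.fst e = c ∨ G.snd e = c) ∧ p.ncard = k

end Multigraph

namespace EdgePacking

open Finset

set_option linter.unusedSectionVars false

variable {V E : Type} [DecidableEq V] [DecidableEq E]

/-- The number of edges of `F` with initial vertex `u`, where the edge `e` joins `p e` and `q e`
and is directed away from `p e` exactly when `o e` holds. -/
def outCount (p q : E → V) (o : E → Bool) (F : Finset E) (u : V) : ℕ :=
  #{e ∈ F | (if o e then p e else q e) = u}

/-- The edges of `F` with exactly one end in `A`. -/
def cut (p q : E → V) (F : Finset E) (A : Finset V) : Finset E :=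
  {e ∈ F | ¬(p e ∈ A ↔ q e ∈ A)}

/-- The edges of `F` with both ends in `A`. -/
def inside (p q : E → V) (F : Finset E) (A : Finset V) : Finset E :=
  {e ∈ F | p e ∈ A ∧ q e ∈ A}

/-- Every nontrivial cut of the vertex set `U` contains an edge of `T`. -/
def CutConnected (p q : E → V) (U : Finset V) (T : Finset E) : Prop :=
  ∀ S ⊆ U, S.Nonempty → S ≠ U → ∃ e ∈ T, ¬(p e ∈ S ↔ q e ∈ S)

/-- `T` is a family of disjoint connected spanning edge sets in the loopless graph on `U` with
edge set `F`. -/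
structure IsPacking {t : ℕ} (p q : E → V) (U : Finset V) (F : Finset E)
    (T : Fin t → Finset E) : Prop where
  ends : ∀ e ∈ F, p e ∈ U ∧ q e ∈ U ∧ p e ≠ q e
  subset : ∀ i, T i ⊆ F
  disjoint : ∀ i j, i ≠ j → Disjoint (T i) (T j)
  connected : ∀ i, CutConnected p q U (T i)

/-- Every admissible prescription of out-degrees modulo `k` on the graph on `U` with edge set `F`
is realised by an orientation. -/
def Orientable (k : ℕ) (p q : E → V) (U : Finset V) (F : Finset E) : Prop :=
  ∀ f : V → ZMod k, (#F : ZMod k) = ∑ u ∈ U, f u →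
    ∃ o : E → Bool, ∀ u ∈ U, (outCount p q o F u : ZMod k) = f u

lemma sum_outCount (p q : E → V) (o : E → Bool) (F : Finset E) (A : Finset V) :
    ∑ u ∈ A, outCount p q o F u = #{e ∈ F | (if o e then p e else q e) ∈ A} := by
  rw [card_eq_sum_card_fiberwise (f := fun e => if o e then p e else q e) (t := A)]
  · refine sum_congr rfl fun u hu => ?_
    unfold outCount
    congr 1
    ext e
    simp only [mem_filter]
    grind
  · intro e he
    simpa using (mem_filter.1 he).2

lemma sum_outCount_eq_card {p q : E → V} {F : Finset E} {U : Finset V}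
    (h : ∀ e ∈ F, p e ∈ U ∧ q e ∈ U) (o : E → Bool) :
    ∑ u ∈ U, outCount p q o F u = #F := by
  rw [sum_outCount, filter_true_of_mem]
  intro e he
  have := h e he
  grind

lemma outCount_union (p q : E → V) (o : E → Bool) {F D : Finset E} (h : Disjoint F D) (u : V) :
    outCount p q o (F ∪ D) u = outCount p q o F u + outCount p q o D u := by
  unfold outCount
  rw [filter_union, card_union_of_disjoint (disjoint_filter_filter h)]

lemma outCount_congr {p q p' q' : E → V} {o o' : E → Bool} {F : Finset E} {u : V}
    (h : ∀ e ∈ F, (if o e then p e else q e) = u ↔ (if o' e then p' e else q' e) = u) :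
    outCount p q o F u = outCount p' q' o' F u := by
  unfold outCount
  rw [filter_congr h]

/-- Orientations of two disjoint edge sets can be glued. -/
lemma outCount_glue (p q : E → V) (o o' : E → Bool) {F D : Finset E} (h : Disjoint F D) (u : V) :
    outCount p q (fun e => if e ∈ D then o' e else o e) (F ∪ D) u =
      outCount p q o F u + outCount p q o' D u := by
  rw [outCount_union p q _ h]
  congr 1
  · refine outCount_congr fun e he => ?_
    simp [disjoint_left.1 h he]
  · refine outCount_congr fun e he => ?_
    simp [he]

lemma exists_outCount_star {k : ℕ} (hk : 0 < k) {p q : E → V} {D : Finset E} {v : V}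
    (hD : ∀ e ∈ D, (p e = v ∨ q e = v) ∧ p e ≠ q e) (hcard : k ≤ #D + 1) (c : ZMod k) :
    ∃ o : E → Bool, (outCount p q o D v : ZMod k) = c := by
  have : NeZero k := ⟨hk.ne'⟩
  have hc := ZMod.val_lt c
  obtain ⟨X, hX, hXc⟩ := exists_subset_card_eq (s := D) (n := c.val) (by omega)
  refine ⟨fun e => decide (p e = v ↔ e ∈ X), ?_⟩
  have : outCount p q (fun e => decide (p e = v ↔ e ∈ X)) D v = #X := by
    unfold outCount
    congr 1
    ext e
    simp only [mem_filter, decide_eq_true_eq]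
    constructor
    · rintro ⟨he, h⟩
      have := hD e he
      grind
    · intro he
      have := hD e (hX he)
      grind
  rw [this, hXc, ZMod.natCast_zmod_val]

lemma inside_connected_of_card_cut_le_one {p q : E → V} {U A : Finset V} {T : Finset E}
    (hT : CutConnected p q U T) (hA : A ⊆ U)
    (hcard : #(cut p q T A) ≤ 1) : CutConnected p q A (inside p q T A) := by
  intro S hS hne hSA
  by_contra! hcon
  have hUS : S ≠ U := fun h => hSA (hS.antisymm (h ▸ hA))
  obtain ⟨e, heT, he⟩ := hT S (hS.trans hA) hne hUS
  obtain ⟨e', heT', he'⟩ := hT (A \ S) (sdiff_subset.trans hA)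
    (sdiff_nonempty.2 fun h => hSA (hS.antisymm h))
    (fun h => hne.ne_empty (by
      ext x
      have := @hS x
      have := @hA x
      have : x ∈ A \ S ↔ x ∈ U := by rw [h]
      grind))
  rw [card_le_one] at hcard
  have h1 := hcon e
  have h2 := hcon e'
  have h3 := hcard e
  have h4 := h3 (by unfold cut; simp only [inside, mem_filter] at *; grind) e'
    (by unfold cut; simp only [inside, mem_filter, mem_sdiff] at *; grind)
  subst h4
  simp only [inside, mem_filter, mem_sdiff] at *
  grind

lemma inside_connected_of_card_cut_le_two {p q : E → V} {U A : Finset V} {T : Finset E}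
    (hT : CutConnected p q U T) (hU : ∀ e ∈ T, p e ∈ U ∧ q e ∈ U) (hA : A ⊆ U)
    (hcard : #(cut p q T A) ≤ 2) :
    CutConnected p q A (inside p q T A) ∨ CutConnected p q (U \ A) (inside p q T (U \ A)) := by
  refine or_iff_not_imp_left.2 fun hconA R hR ⟨r, hr⟩ hRB => ?_
  unfold CutConnected at hconA
  push Not at hconA
  obtain ⟨S, hS, hne, hSA, hSe⟩ := hconA
  obtain ⟨s', hs'⟩ : (A \ S).Nonempty := sdiff_nonempty.2 fun h => hSA (hS.antisymm h)
  obtain ⟨r', hr'⟩ : ((U \ A) \ R).Nonempty := sdiff_nonempty.2 fun h => hRB (hR.antisymm h)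
  have hS' : ∀ x, x ∈ S → x ∈ A := fun x hx => hS hx
  have hR' : ∀ x, x ∈ R → x ∈ U ∧ x ∉ A := fun x hx => mem_sdiff.1 (hR hx)
  have hsame : ∀ e ∈ T, e ∉ cut p q T A → (p e ∈ A ↔ q e ∈ A) ∧ (p e ∈ S ↔ q e ∈ S) := by
    intro e he hec
    have hpq : p e ∈ A ↔ q e ∈ A := by_contra fun h => hec (mem_filter.2 ⟨he, h⟩)
    refine ⟨hpq, ?_⟩
    by_cases hp : p e ∈ A
    · exact hSe e (mem_filter.2 ⟨he, hp, hpq.1 hp⟩)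
    · exact iff_of_false (fun h => hp (hS h)) (fun h => hp (hpq.2 (hS h)))
  obtain ⟨s, hs⟩ := hne
  simp only [mem_sdiff] at hs' hr'
  obtain ⟨a, haT, ha⟩ := hT S (hS.trans hA) ⟨s, hs⟩ (fun h => hs'.2 (h ▸ hA hs'.1))
  obtain ⟨b, hbT, hb⟩ := hT (A \ S) (sdiff_subset.trans hA) ⟨s', mem_sdiff.2 hs'⟩
    (fun h => by have := h ▸ hA (hS hs); exact (mem_sdiff.1 this).2 hs)
  simp only [mem_sdiff] at hb
  have haC : a ∈ cut p q T A := by_contra fun h => ha (hsame a haT h).2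
  have hbC : b ∈ cut p q T A := by_contra fun h => by
    have := hsame b hbT h
    tauto
  have haA := (mem_filter.1 haC).2
  have hbA := (mem_filter.1 hbC).2
  have hab : a ≠ b := by
    rintro rfl
    have := hS' (p a)
    have := hS' (q a)
    tauto
  have hC : {a, b} = cut p q T A := by
    refine eq_of_subset_of_card_le (insert_subset haC (singleton_subset_iff.2 hbC)) ?_
    rwa [card_pair hab]
  obtain ⟨e, heT, he⟩ := hT (R ∪ {x ∈ A | (x ∈ S ∧ (p a ∈ R ∨ q a ∈ R)) ∨
      (x ∉ S ∧ (p b ∈ R ∨ q b ∈ R))})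
    (union_subset (hR.trans sdiff_subset) ((filter_subset _ _).trans hA))
    ⟨r, mem_union_left _ hr⟩ (fun h => by
      have : r' ∈ U := hr'.1.1
      rw [← h, mem_union, mem_filter] at this
      tauto)
  simp only [mem_union, mem_filter] at he
  have heC : e ∉ cut p q T A := by
    rw [← hC, mem_insert, mem_singleton]
    rintro (rfl | rfl)
    · have h1 := hS' (p e)
      have h2 := hS' (q e)
      have h3 := hR' (p e)
      have h4 := hR' (q e)
      clear * - h1 h2 h3 h4 ha haA he
      grind
    · have h1 := hS' (p e)
      have h2 := hS' (q e)
      have h3 := hR' (p e)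
      have h4 := hR' (q e)
      clear * - h1 h2 h3 h4 hb hbA he
      grind
  obtain ⟨h1, h2⟩ := hsame e heT heC
  have h3 := hU e heT
  by_cases hp : p e ∈ A
  · have h4 := hR' (p e)
    have h5 := hR' (q e)
    clear * - h1 h2 h4 h5 hp he
    grind
  · refine ⟨e, mem_filter.2 ⟨heT, mem_sdiff.2 ⟨h3.1, hp⟩, mem_sdiff.2 ⟨h3.2, fun h => hp (h1.2 h)⟩⟩, ?_⟩
    simpa [hp, h1.not.1 hp] using he

lemma CutConnected.map {W : Type} [DecidableEq W] {p q : E → V} {U : Finset V} {T T' : Finset E}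
    (hT : CutConnected p q U T) (hU : ∀ e ∈ T, p e ∈ U ∧ q e ∈ U) {U' : Finset W} {r : V → W}
    (hr : Set.SurjOn r U U') (hT' : ∀ e ∈ T, r (p e) ≠ r (q e) → e ∈ T') :
    CutConnected (r ∘ p) (r ∘ q) U' T' := by
  rintro S hS ⟨s, hs⟩ hSU
  obtain ⟨y, hy⟩ : (U' \ S).Nonempty := sdiff_nonempty.2 fun h => hSU (hS.antisymm h)
  rw [mem_sdiff] at hy
  obtain ⟨s', hs'U, rfl⟩ := hr (hS hs)
  obtain ⟨y', hy'U, rfl⟩ := hr hy.1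
  obtain ⟨e, he, heS⟩ := hT {x ∈ U | r x ∈ S} (filter_subset _ _)
    ⟨s', mem_filter.2 ⟨hs'U, hs⟩⟩ (fun h => hy.2 (mem_filter.1 (h ▸ hy'U : y' ∈ _)).2)
  have := hU e he
  simp only [mem_filter, this.1, this.2, true_and] at heS
  exact ⟨e, hT' e he fun h => heS (by rw [h]), heS⟩

lemma cut_sdiff {p q : E → V} {U : Finset V} {T : Finset E}
    (hU : ∀ e ∈ T, p e ∈ U ∧ q e ∈ U) (A : Finset V) :
    cut p q T (U \ A) = cut p q T A := by
  refine filter_congr fun e he => ?_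
  have := hU e he
  simp only [mem_sdiff, this.1, this.2, true_and, not_iff_not]

lemma IsPacking.sum_card_cut_sub_one_add_le {t : ℕ} {p q : E → V} {U A : Finset V} {F : Finset E}
    {T : Fin t → Finset E} (h : IsPacking p q U F T) (hA : A ⊆ U) (hne : A.Nonempty)
    (hAU : A ≠ U) : ∑ i, (#(cut p q (T i) A) - 1) + t ≤ #(cut p q F A) := by
  have h1 : ∑ i, #(cut p q (T i) A) ≤ #(cut p q F A) := by
    rw [← card_biUnion (t := fun i => cut p q (T i) A) fun i _ j _ hij =>
      disjoint_filter_filter (h.disjoint i j hij)]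
    exact card_le_card (biUnion_subset.2 fun i _ => filter_subset_filter _ (h.subset i))
  have h2 : ∑ i, #(cut p q (T i) A) = ∑ i, (#(cut p q (T i) A) - 1) + t := by
    have : ∑ i : Fin t, #(cut p q (T i) A) = ∑ i, ((#(cut p q (T i) A) - 1) + 1) := by
      refine sum_congr rfl fun i _ => (Nat.sub_add_cancel ?_).symm
      obtain ⟨e, he, heA⟩ := h.connected i A hA hne hAU
      exact card_pos.2 ⟨e, mem_filter.2 ⟨he, heA⟩⟩
    rw [this, sum_add_distrib]
    simp
  omega

lemma IsPacking.card_cut_add_le {t : ℕ} {p q : E → V} {U A : Finset V} {F : Finset E}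
    {T : Fin t → Finset E} (h : IsPacking p q U F T) (hA : A ⊆ U) (hne : A.Nonempty)
    (hAU : A ≠ U) (i : Fin t) : #(cut p q (T i) A) + t ≤ #(cut p q F A) + 1 := by
  have h1 := h.sum_card_cut_sub_one_add_le hA hne hAU
  have h2 := single_le_sum (f := fun i => #(cut p q (T i) A) - 1) (fun _ _ => Nat.zero_le _)
    (mem_univ i)
  omega

lemma IsPacking.card_cut_le_one {t : ℕ} {p q : E → V} {U A : Finset V} {F : Finset E}
    {T : Fin t → Finset E} (h : IsPacking p q U F T) (hA : A ⊆ U) (hne : A.Nonempty)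
    (hAU : A ≠ U) (hcut : #(cut p q F A) < t + 2) {i j : Fin t} (hij : i ≠ j)
    (hj : 1 < #(cut p q (T j) A)) : #(cut p q (T i) A) ≤ 1 := by
  have h1 := h.sum_card_cut_sub_one_add_le hA hne hAU
  have h2 := add_le_sum (f := fun i => #(cut p q (T i) A) - 1) (fun _ _ => Nat.zero_le _)
    (mem_univ i) (mem_univ j) hij
  omega

lemma IsPacking.inside_connected {t : ℕ} {p q : E → V} {U A : Finset V} {F : Finset E}
    {T : Fin t → Finset E} (h : IsPacking p q U F T) (hA : A ⊆ U) (hne : A.Nonempty)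
    (hAU : A ≠ U) (hcut : #(cut p q F A) < t + 2) :
    (∀ i, CutConnected p q A (inside p q (T i) A)) ∨
      ∀ i, CutConnected p q (U \ A) (inside p q (T i) (U \ A)) := by
  have hends : ∀ i, ∀ e ∈ T i, p e ∈ U ∧ q e ∈ U := fun i e he =>
    ⟨(h.ends e (h.subset i he)).1, (h.ends e (h.subset i he)).2.1⟩
  by_cases hj : ∃ j, 1 < #(cut p q (T j) A)
  · obtain ⟨j, hj⟩ := hj
    have h2 := h.card_cut_add_le hA hne hAU j
    refine (inside_connected_of_card_cut_le_two (h.connected j) (hends j) hA (by omega)).imp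
      (fun hc i => ?_) (fun hc i => ?_) <;>
    · obtain rfl | hij := eq_or_ne i j
      · exact hc
      · have := h.card_cut_le_one hA hne hAU hcut hij hj
        refine inside_connected_of_card_cut_le_one (h.connected i) (by simp [hA]) ?_
        first | exact this | rwa [cut_sdiff (hends i)]
  · push Not at hj
    exact Or.inl fun i => inside_connected_of_card_cut_le_one (h.connected i) hA (hj i)

/-- The family obtained by restriction to a vertex set on which all members stay connected. -/
lemma IsPacking.restrict {t : ℕ} {p q : E → V} {U A : Finset V} {F : Finset E}
    {T : Fin t → Finset E} (h : IsPacking p q U F T)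
    (hc : ∀ i, CutConnected p q A (inside p q (T i) A)) :
    IsPacking p q A (inside p q F A) (fun i => inside p q (T i) A) where
  ends e he := ⟨(mem_filter.1 he).2.1, (mem_filter.1 he).2.2, (h.ends e (mem_filter.1 he).1).2.2⟩
  subset i := filter_subset_filter _ (h.subset i)
  disjoint i j hij := disjoint_filter_filter (h.disjoint i j hij)
  connected := hc

lemma IsPacking.contract {t : ℕ} {p q : E → V} {U A : Finset V} {F : Finset E}
    {T : Fin t → Finset E} (h : IsPacking p q U F T) (hA : A ⊆ U) {a : V} (ha : a ∈ A) :
    IsPacking ((fun x => if x ∈ A then a else x) ∘ p) ((fun x => if x ∈ A then a else x) ∘ q)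
      (insert a (U \ A)) (F \ inside p q F A) (fun i => T i \ inside p q F A) where
  ends e he := by
    have h1 := h.ends e (mem_sdiff.1 he).1
    have h2 : ¬(p e ∈ A ∧ q e ∈ A) := fun hh =>
      (mem_sdiff.1 he).2 (mem_filter.2 ⟨(mem_sdiff.1 he).1, hh⟩)
    simp only [Function.comp_apply, mem_insert, mem_sdiff]
    clear * - h1 h2 ha
    grind
  subset i := sdiff_subset_sdiff (h.subset i) le_rfl
  disjoint i j hij := (h.disjoint i j hij).mono sdiff_subset sdiff_subset
  connected i := by
    refine (h.connected i).map (fun e he => ?_) (fun x hx => ?_) fun e he hne => ?_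
    · exact ⟨(h.ends e (h.subset i he)).1, (h.ends e (h.subset i he)).2.1⟩
    · obtain rfl | hx := mem_insert.1 hx
      · exact ⟨x, hA ha, by simp⟩
      · exact ⟨x, (mem_sdiff.1 hx).1, by simp [(mem_sdiff.1 hx).2]⟩
    · refine mem_sdiff.2 ⟨he, fun hi => hne ?_⟩
      simp [(mem_filter.1 hi).2.1, (mem_filter.1 hi).2.2]

lemma outCount_inside_eq_zero {p q : E → V} {o : E → Bool} {F : Finset E} {A : Finset V} {u : V}
    (hu : u ∉ A) : outCount p q o (inside p q F A) u = 0 := by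
  refine card_eq_zero.2 (filter_eq_empty_iff.2 fun e he hh => hu ?_)
  have := (mem_filter.1 he).2
  rw [← hh]
  split_ifs
  · exact this.1
  · exact this.2

/-- Orientations of a contraction extend to the whole graph when the contracted part is
orientable. -/
lemma Orientable.of_contract {k : ℕ} {p q : E → V} {U A : Finset V} {F : Finset E} (hA : A ⊆ U)
    {a : V} (ha : a ∈ A)
    (h : Orientable k ((fun x => if x ∈ A then a else x) ∘ p)
      ((fun x => if x ∈ A then a else x) ∘ q) (insert a (U \ A)) (F \ inside p q F A))
    (hin : Orientable k p q A (inside p q F A)) : Orientable k p q U F := by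
  intro f hf
  have hIF : inside p q F A ⊆ F := filter_subset _ _
  have hcard : (#(F \ inside p q F A) : ZMod k) = #F - #(inside p q F A) := by
    rw [card_sdiff_of_subset hIF, Nat.cast_sub (card_le_card hIF)]
  have hsum : ∑ u ∈ U \ A, f u + ∑ u ∈ A, f u = ∑ u ∈ U, f u := sum_sdiff hA
  obtain ⟨o, ho⟩ := h (fun u => if u = a then ∑ u ∈ A, f u - #(inside p q F A) else f u) (by
    have : ∑ u ∈ U \ A, (if u = a then ∑ u ∈ A, f u - (#(inside p q F A) : ZMod k) else f u) =
        ∑ u ∈ U \ A, f u := by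
      refine sum_congr rfl fun u hu => if_neg ?_
      rintro rfl
      exact (mem_sdiff.1 hu).2 ha
    rw [sum_insert (by simp [ha]), this, if_pos rfl, hcard, hf, ← hsum]
    ring)
  have htail : ∀ e, (if o e then ((fun x => if x ∈ A then a else x) ∘ p) e
      else ((fun x => if x ∈ A then a else x) ∘ q) e) =
      if (if o e then p e else q e) ∈ A then a else (if o e then p e else q e) := by
    intro e
    cases o e <;> rfl
  obtain ⟨o', ho'⟩ := hin (fun u => f u - outCount p q o (F \ inside p q F A) u) (by
    have h1 := ho a (mem_insert_self _ _)
    rw [if_pos rfl] at h1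
    have h2 : outCount ((fun x => if x ∈ A then a else x) ∘ p)
        ((fun x => if x ∈ A then a else x) ∘ q) o (F \ inside p q F A) a =
        ∑ u ∈ A, outCount p q o (F \ inside p q F A) u := by
      rw [sum_outCount]
      unfold outCount
      congr 1
      refine filter_congr fun e _ => ?_
      rw [htail]
      generalize (if o e then p e else q e) = x
      split_ifs with h
      · simp [h]
      · exact iff_of_false (fun hh => h (hh ▸ ha)) h
    rw [sum_sub_distrib, ← Nat.cast_sum, ← h2, h1]
    ring)
  refine ⟨fun e => if e ∈ F \ inside p q F A then o e else o' e, fun u hu => ?_⟩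
  have hglue := outCount_glue p q o' o (disjoint_sdiff (s := inside p q F A) (t := F)) u
  rw [union_sdiff_of_subset hIF] at hglue
  rw [hglue, Nat.cast_add]
  by_cases huA : u ∈ A
  · rw [ho' u huA]
    ring
  · have h1 := ho u (mem_insert_of_mem (mem_sdiff.2 ⟨hu, huA⟩))
    rw [if_neg (ne_of_mem_of_not_mem ha huA).symm] at h1
    rw [outCount_inside_eq_zero huA, ← h1, Nat.cast_zero, zero_add]
    congr 1
    refine outCount_congr fun e _ => ?_
    rw [htail]
    generalize (if o e then p e else q e) = x
    split_ifs with h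
    · exact iff_of_false (fun hh => huA (hh ▸ h)) (fun hh => huA (hh ▸ ha))
    · rfl

lemma outCount_insert {p q : E → V} {o : E → Bool} {F : Finset E} {a : E} (ha : a ∉ F) (u : V) :
    outCount p q o (insert a F) u =
      outCount p q o F u + if (if o a then p a else q a) = u then 1 else 0 := by
  unfold outCount
  rw [filter_insert]
  split_ifs <;> simp_all

lemma mem_cut_singleton {p q : E → V} {F : Finset E} {v : V} {e : E} :
    e ∈ cut p q F {v} ↔ e ∈ F ∧ ¬(p e = v ↔ q e = v) := by
  simp [cut]

lemma inside_erase_union_cut {p q : E → V} {U : Finset V} {F : Finset E}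
    (hF : ∀ e ∈ F, p e ∈ U ∧ q e ∈ U ∧ p e ≠ q e) (v : V) :
    inside p q F (U.erase v) ∪ cut p q F {v} = F := by
  ext e
  have := hF e
  simp only [mem_union, mem_cut_singleton, inside, mem_filter, mem_erase]
  clear hF
  grind

lemma disjoint_inside_erase_cut {p q : E → V} {U : Finset V} {F : Finset E} (v : V) :
    Disjoint (inside p q F (U.erase v)) (cut p q F {v}) := by
  refine disjoint_left.2 fun e he hc => ?_
  rw [mem_cut_singleton] at hc
  simp only [inside, mem_filter, mem_erase] at he
  tauto

/-- A vertex of sufficiently large degree can be deleted. -/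
lemma Orientable.of_erase {k : ℕ} (hk : 0 < k) {p q : E → V} {U : Finset V} {F : Finset E}
    (hF : ∀ e ∈ F, p e ∈ U ∧ q e ∈ U ∧ p e ≠ q e) {v : V} (hv : v ∈ U)
    (hcard : k ≤ #(cut p q F {v}) + 1)
    (h : Orientable k p q (U.erase v) (inside p q F (U.erase v))) : Orientable k p q U F := by
  intro f hf
  have hunion := inside_erase_union_cut hF v
  have hdisj := disjoint_inside_erase_cut (p := p) (q := q) (U := U) (F := F) v
  obtain ⟨o, ho⟩ := exists_outCount_star (p := p) (q := q) hk (D := cut p q F {v}) (v := v)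
    (fun e he => by
      rw [mem_cut_singleton] at he
      exact ⟨by tauto, (hF e he.1).2.2⟩) hcard (f v)
  obtain ⟨o', ho'⟩ := h (fun u => f u - outCount p q o (cut p q F {v}) u) (by
    have h1 := sum_outCount_eq_card (p := p) (q := q) (F := cut p q F {v}) (U := U)
      (fun e he => ⟨(hF e (mem_filter.1 he).1).1, (hF e (mem_filter.1 he).1).2.1⟩) o
    have h2 : #F = #(inside p q F (U.erase v)) + #(cut p q F {v}) := by
      rw [← card_union_of_disjoint hdisj, hunion]
    rw [h2, ← h1, ← add_sum_erase U _ hv, ← add_sum_erase U _ hv] at hf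
    push_cast at hf
    rw [ho] at hf
    rw [sum_sub_distrib]
    linear_combination hf)
  refine ⟨fun e => if e ∈ cut p q F {v} then o e else o' e, fun u hu => ?_⟩
  have hglue := outCount_glue p q o' o hdisj u
  rw [hunion] at hglue
  rw [hglue, Nat.cast_add]
  obtain rfl | huv := eq_or_ne u v
  · rw [outCount_inside_eq_zero (notMem_erase _ _), ho, Nat.cast_zero, zero_add]
  · rw [ho' u (mem_erase.2 ⟨huv, hu⟩), sub_add_cancel]

/-- Two edges at the vertex `v` are replaced by a single edge joining their other ends, one of
which is `x`, and the vertex `v` is deleted. -/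
lemma Orientable.of_splitting {k : ℕ} (hk : 0 < k) {p q : E → V} {U : Finset V} {F : Finset E}
    (hF : ∀ e ∈ F, p e ∈ U ∧ q e ∈ U ∧ p e ≠ q e) {v x : V} (hv : v ∈ U) {a b : E} (hab : a ≠ b)
    (ha : a ∈ cut p q F {v}) (hb : b ∈ cut p q F {v}) (hx : x ≠ v) (hax : p a = x ∨ q a = x)
    (hcard : k + 1 ≤ #(cut p q F {v}))
    (h : Orientable k ((fun y => if y = v then x else y) ∘ p)
      ((fun y => if y = v then x else y) ∘ q) (U.erase v)
      (insert b (inside p q F (U.erase v)))) : Orientable k p q U F := by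
  intro f hf
  have hdisj := disjoint_inside_erase_cut (p := p) (q := q) (U := U) (F := F) v
  have haI := disjoint_right.1 hdisj ha
  have hbI := disjoint_right.1 hdisj hb
  have hunion := inside_erase_union_cut hF v
  set I := inside p q F (U.erase v) with hI
  set D := (cut p q F {v}).erase a |>.erase b with hD
  have hbD : b ∈ (cut p q F {v}).erase a := mem_erase.2 ⟨hab.symm, hb⟩
  have haI' : a ∉ insert b I := by simp [hab, haI]
  have hdisj' : Disjoint (insert a (insert b I)) D := by
    refine disjoint_insert_left.2 ⟨by simp [hD], disjoint_insert_left.2 ⟨by simp [hD], ?_⟩⟩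
    exact hdisj.mono_right ((erase_subset _ _).trans (erase_subset _ _))
  have hunion' : insert a (insert b I) ∪ D = F := by
    rw [← hunion, insert_union, insert_union, ← union_insert, insert_erase hbD, ← union_insert,
      insert_erase ha]
  have hDcut : D ⊆ cut p q F {v} := (erase_subset _ _).trans (erase_subset _ _)
  have hDcard : #D + 2 = #(cut p q F {v}) := by
    have h1 : #D + 1 = _ := card_erase_add_one hbD
    have h2 := card_erase_add_one ha
    omega
  obtain ⟨o, ho⟩ := exists_outCount_star (p := p) (q := q) hk (D := D) (v := v)
    (fun e he => by
      have he := mem_cut_singleton.1 (hDcut he)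
      exact ⟨by tauto, (hF e he.1).2.2⟩) (by omega) (f v - 1)
  obtain ⟨o', ho'⟩ := h (fun u => f u - outCount p q o D u) (by
    have h1 := sum_outCount_eq_card (p := p) (q := q) (F := D) (U := U)
      (fun e he => by
        have he := mem_cut_singleton.1 (hDcut he)
        exact ⟨(hF e he.1).1, (hF e he.1).2.1⟩) o
    have h2 : #F = #(insert b I) + 1 + #D := by
      rw [← card_insert_of_notMem haI', ← card_union_of_disjoint hdisj', hunion']
    rw [h2, ← h1, ← add_sum_erase U _ hv, ← add_sum_erase U _ hv] at hf
    push_cast at hf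
    rw [ho] at hf
    rw [sum_sub_distrib]
    linear_combination hf)
  obtain ⟨oa, hoa⟩ : ∃ c : Bool, (if c then p a else q a) =
      if (if o' b then p b else q b) = v then x else v := by
    have := (mem_cut_singleton.1 ha).2
    by_cases hbv : (if o' b then p b else q b) = v
    · rw [if_pos hbv]
      obtain h | h := hax
      · exact ⟨true, h⟩
      · exact ⟨false, h⟩
    · rw [if_neg hbv]
      by_cases hp : p a = v
      · exact ⟨true, hp⟩
      · exact ⟨false, by simpa [hp] using this⟩
  refine ⟨fun e => if e ∈ D then o e else if e = a then oa else o' e, fun u hu => ?_⟩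
  have hglue := outCount_glue p q (fun e => if e = a then oa else o' e) o hdisj' u
  rw [hunion'] at hglue
  rw [hglue, Nat.cast_add, outCount_insert haI', outCount_insert hbI]
  simp only [if_neg hab.symm, if_true, hoa]
  obtain rfl | huv := eq_or_ne u v
  · rw [hI, outCount_inside_eq_zero (notMem_erase _ _), ho]
    split_ifs <;> simp_all
  · have h1 := ho' u (mem_erase.2 ⟨huv, hu⟩)
    rw [outCount_insert hbI] at h1
    have h2 : outCount p q (fun e => if e = a then oa else o' e) I u =
        outCount ((fun y => if y = v then x else y) ∘ p)
          ((fun y => if y = v then x else y) ∘ q) o' I u := by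
      refine outCount_congr fun e he => ?_
      have hea : e ≠ a := fun h => haI (h ▸ he)
      have hev := (mem_filter.1 he).2
      simp only [mem_erase] at hev
      simp [hea, hev.1.1, hev.2.1]
    have h3 : (if o' b then ((fun y => if y = v then x else y) ∘ p) b
        else ((fun y => if y = v then x else y) ∘ q) b) =
        if (if o' b then p b else q b) = v then x else (if o' b then p b else q b) := by
      cases o' b <;> rfl
    rw [h3] at h1
    rw [eq_sub_iff_add_eq] at h1
    rw [h2, ← h1, add_assoc]
    congr 3
    generalize (if o' b then p b else q b) = y
    clear * - huv
    by_cases hy : y = v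
    · simp [hy, huv.symm]
    · simp [hy, huv.symm]

lemma CutConnected.congr {p q p' q' : E → V} {U : Finset V} {T : Finset E}
    (h : CutConnected p q U T) (hpq : ∀ e ∈ T, p e = p' e ∧ q e = q' e) :
    CutConnected p' q' U T := by
  intro S hS hne hSU
  obtain ⟨e, he, heS⟩ := h S hS hne hSU
  exact ⟨e, he, by rwa [← (hpq e he).1, ← (hpq e he).2]⟩

lemma comp_eq_of_mem_inside_erase {p q : E → V} {U : Finset V} {T : Finset E} {v x : V} {e : E}
    (he : e ∈ inside p q T (U.erase v)) :
    p e = ((fun y => if y = v then x else y) ∘ p) e ∧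
      q e = ((fun y => if y = v then x else y) ∘ q) e := by
  have := (mem_filter.1 he).2
  simp only [mem_erase] at this
  simp [this.1.1, this.2.1]

lemma CutConnected.splitting {p q : E → V} {U : Finset V} {T T' : Finset E}
    (hT : CutConnected p q U T) (hU : ∀ e ∈ T, p e ∈ U ∧ q e ∈ U) {v x : V} (hx : x ≠ v)
    {a b : E} (hab : cut p q T {v} = {a, b}) (hax : p a = x ∨ q a = x)
    (hT' : inside p q T (U.erase v) ⊆ T')
    (hb : (if p b = v then x else p b) ≠ (if q b = v then x else q b) → b ∈ T') :
    CutConnected ((fun y => if y = v then x else y) ∘ p)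
      ((fun y => if y = v then x else y) ∘ q) (U.erase v) T' := by
  refine hT.map hU (fun y hy => ⟨y, (mem_erase.1 hy).2, if_neg (mem_erase.1 hy).1⟩) ?_
  intro e he hne
  have hpq : ¬(p e = v ∧ q e = v) := fun h => hne (by simp [h.1, h.2])
  by_cases hc : e ∈ cut p q T {v}
  · have hc' := mem_cut_singleton.1 hc
    rw [hab, mem_insert, mem_singleton] at hc
    obtain rfl | rfl := hc
    · exfalso
      apply hne
      clear * - hc' hax hx
      grind
    · exact hb hne
  · rw [mem_cut_singleton] at hc
    refine hT' (mem_filter.2 ⟨he, ?_⟩)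
    have := hU e he
    simp only [mem_erase]
    tauto

lemma IsPacking.splitting {t : ℕ} {p q : E → V} {U : Finset V} {F : Finset E}
    {T : Fin t → Finset E} (h : IsPacking p q U F T) {v x : V} {j : Fin t} (hxU : x ∈ U)
    (hx : x ≠ v) {a b : E} (hab : cut p q (T j) {v} = {a, b}) (hax : p a = x ∨ q a = x)
    (hb : (if p b = v then x else p b) ≠ (if q b = v then x else q b))
    (hc : ∀ i, i ≠ j → CutConnected p q (U.erase v) (inside p q (T i) (U.erase v))) :
    IsPacking ((fun y => if y = v then x else y) ∘ p) ((fun y => if y = v then x else y) ∘ q)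
      (U.erase v) (insert b (inside p q F (U.erase v)))
      (fun i => if i = j then insert b (inside p q (T j) (U.erase v))
        else inside p q (T i) (U.erase v)) where
  ends e he := by
    obtain rfl | he := mem_insert.1 he
    · have hbT : e ∈ cut p q (T j) {v} := by simp [hab]
      have hbF := h.ends e (h.subset j (mem_filter.1 hbT).1)
      refine ⟨?_, ?_, hb⟩ <;>
      · simp only [Function.comp_apply, mem_erase]
        split_ifs <;> simp_all
    · have h1 := comp_eq_of_mem_inside_erase (x := x) he
      rw [← h1.1, ← h1.2]
      exact ⟨(mem_filter.1 he).2.1, (mem_filter.1 he).2.2, (h.ends e (mem_filter.1 he).1).2.2⟩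
  subset i := by
    split_ifs with hi
    · exact insert_subset_insert _ (filter_subset_filter _ (h.subset j))
    · exact (filter_subset_filter _ (h.subset i)).trans (subset_insert _ _)
  disjoint := by
    have hbT : b ∈ cut p q (T j) {v} := by simp [hab]
    have hb' : ∀ i, b ∉ inside p q (T i) (U.erase v) := by
      intro i hi
      have h1 := (mem_filter.1 hi).2
      have h2 := (mem_cut_singleton.1 hbT).2
      simp only [mem_erase] at h1
      tauto
    have hd : ∀ i i', i ≠ i' →
        Disjoint (inside p q (T i) (U.erase v)) (inside p q (T i') (U.erase v)) :=
      fun i i' hii' => disjoint_filter_filter (h.disjoint i i' hii')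
    intro i i' hii'
    split_ifs with h1 h2 h2
    · exact absurd (h1.trans h2.symm) hii'
    · exact disjoint_insert_left.2 ⟨hb' _, hd _ _ (Ne.symm h2)⟩
    · exact disjoint_insert_right.2 ⟨hb' _, hd _ _ h1⟩
    · exact hd _ _ hii'
  connected i := by
    split_ifs with hi
    · refine (h.connected j).splitting (fun e he => ?_) hx hab hax (subset_insert _ _)
        fun _ => mem_insert_self _ _
      exact ⟨(h.ends e (h.subset j he)).1, (h.ends e (h.subset j he)).2.1⟩
    · exact (hc i hi).congr fun e he => comp_eq_of_mem_inside_erase he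

/-- The inductive step at a vertex of small degree. -/
lemma IsPacking.orientable_of_small_degree {k t : ℕ} (hk : 0 < k) (hkt : k ≤ t) {p q : E → V}
    {U : Finset V} {F : Finset E} {T : Fin t → Finset E} (h : IsPacking p q U F T)
    (ih : ∀ (p q : E → V) (U' : Finset V) (F : Finset E) (T : Fin t → Finset E),
      #U' < #U → IsPacking p q U' F T → Orientable k p q U' F)
    {v : V} (hv : v ∈ U) (hvU : {v} ≠ U) (hcut : #(cut p q F {v}) < t + 2) :
    Orientable k p q U F := by
  have hvU' : ({v} : Finset V) ⊆ U := singleton_subset_iff.2 hv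
  have hends : ∀ i, ∀ e ∈ T i, p e ∈ U ∧ q e ∈ U := fun i e he =>
    ⟨(h.ends e (h.subset i he)).1, (h.ends e (h.subset i he)).2.1⟩
  have hlt : #(U.erase v) < #U := card_erase_lt_of_mem hv
  have hle := h.sum_card_cut_sub_one_add_le hvU' (singleton_nonempty v) hvU
  have hone : ∀ i, #(cut p q (T i) {v}) ≤ 1 →
      CutConnected p q (U.erase v) (inside p q (T i) (U.erase v)) := by
    intro i hi
    rw [← sdiff_singleton_eq_erase]
    refine inside_connected_of_card_cut_le_one (h.connected i) sdiff_subset ?_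
    rwa [cut_sdiff (hends i)]
  by_cases hc : ∀ i, CutConnected p q (U.erase v) (inside p q (T i) (U.erase v))
  · exact .of_erase hk h.ends hv (by omega) (ih _ _ _ _ _ hlt (h.restrict hc))
  push Not at hc
  obtain ⟨j, hj⟩ := hc
  have hj1 : 1 < #(cut p q (T j) {v}) := by
    by_contra hj1
    exact hj (hone j (by omega))
  have hj2 := h.card_cut_add_le hvU' (singleton_nonempty v) hvU j
  obtain ⟨a, b, hab, hjab⟩ := card_eq_two.1 (show #(cut p q (T j) {v}) = 2 by omega)
  have hsub : cut p q (T j) {v} ⊆ cut p q F {v} := filter_subset_filter _ (h.subset j)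
  have ha : a ∈ cut p q F {v} := hsub (by simp [hjab])
  have hb : b ∈ cut p q F {v} := hsub (by simp [hjab])
  obtain ⟨x, hxU, hxv, hax⟩ : ∃ x ∈ U, x ≠ v ∧ (p a = x ∨ q a = x) := by
    have h1 := mem_cut_singleton.1 ha
    have h2 := h.ends a h1.1
    by_cases hp : p a = v
    · exact ⟨q a, h2.2.1, by tauto, Or.inr rfl⟩
    · exact ⟨p a, h2.1, hp, Or.inl rfl⟩
  have hbx : (if p b = v then x else p b) ≠ (if q b = v then x else q b) := by
    intro hbx
    refine hj (((h.connected j).splitting (hends j) hxv hjab hax le_rfl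
      fun hne => absurd hbx hne).congr fun e he => ?_)
    have := comp_eq_of_mem_inside_erase (x := x) he
    exact ⟨this.1.symm, this.2.symm⟩
  refine .of_splitting hk h.ends hv hab ha hb hxv hax (by omega) (ih _ _ _ _ _ hlt
    (h.splitting hxU hxv hjab hax hbx fun i hij => hone i ?_))
  exact h.card_cut_le_one hvU' (singleton_nonempty v) hvU hcut hij hj1

/-- The inductive step at a small cut one of whose sides meets all members of the packing in
connected sets. -/
lemma IsPacking.orientable_of_small_cut {k t : ℕ} (hk : 0 < k) (hkt : k ≤ t) {p q : E → V}
    {U : Finset V} {F : Finset E} {T : Fin t → Finset E} (h : IsPacking p q U F T)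
    (ih : ∀ (p q : E → V) (U' : Finset V) (F : Finset E) (T : Fin t → Finset E),
      #U' < #U → IsPacking p q U' F T → Orientable k p q U' F)
    {A : Finset V} (hA : A ⊆ U) (hne : A.Nonempty) (hAU : A ≠ U)
    (hcut : #(cut p q F A) < t + 2)
    (hc : ∀ i, CutConnected p q A (inside p q (T i) A)) : Orientable k p q U F := by
  obtain ⟨a, ha⟩ := hne
  by_cases hA1 : 1 < #A
  · have hcard : #(insert a (U \ A)) < #U := by
      have h1 := card_insert_le a (U \ A)
      have h2 := card_sdiff_add_card_eq_card hA
      omega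
    exact .of_contract hA ha (ih _ _ _ _ _ hcard (h.contract hA ha))
      (ih _ _ _ _ _ (card_lt_card (hA.ssubset_of_ne hAU)) (h.restrict hc))
  · obtain rfl : A = {a} := by
      refine (eq_of_subset_of_card_le (singleton_subset_iff.2 ha) ?_).symm
      rw [card_singleton]
      omega
    exact h.orientable_of_small_degree hk hkt ih (hA ha) hAU hcut

lemma reflTransGen_of_cut {W F : Type} (H : Multigraph W F)
    (h : ∀ S : Set W, S.Nonempty → S ≠ Set.univ → (H.cutEdges S).Nonempty) (u v : W) :
    Relation.ReflTransGen (H.AdjOn Set.univ) u v := by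
  by_contra hv
  obtain ⟨e, he⟩ := h {w | Relation.ReflTransGen (H.AdjOn Set.univ) u w} ⟨u, .refl⟩
    (fun hS => hv (hS ▸ Set.mem_univ v : v ∈ {w | Relation.ReflTransGen _ u w}))
  obtain ⟨h1, h2⟩ | ⟨h1, h2⟩ := he
  · exact h2 (h1.tail ⟨e, trivial, Or.inl ⟨rfl, rfl⟩⟩)
  · exact h1 (h2.tail ⟨e, trivial, Or.inr ⟨rfl, rfl⟩⟩)

/-- Orientability of highly edge-connected multigraphs, transferred to graphs given by finite
sets of vertices and edges. -/
lemma orientable_of_cut {k lam : ℕ} (hlam : 0 < lam)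
    (hyp : ∀ (W F : Type) [Fintype W] [Fintype F] (H : Multigraph W F),
      H.EdgeConnected lam →
        ∀ g : W → ZMod k, (Nat.card F : ZMod k) = ∑ w, g w →
          ∃ o : F → Bool, H.IsModOrientation k g o)
    {p q : E → V} {U : Finset V} {F : Finset E}
    (hF : ∀ e ∈ F, p e ∈ U ∧ q e ∈ U ∧ p e ≠ q e)
    (hcut : ∀ S ⊆ U, S.Nonempty → S ≠ U → lam ≤ #(cut p q F S)) : Orientable k p q U F := by
  intro f hf
  let H : Multigraph U F :=
    { fst := fun e => ⟨p e, (hF e e.2).1⟩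
      snd := fun e => ⟨q e, (hF e e.2).2.1⟩
      loopless := fun e h => (hF e e.2).2.2 (congrArg Subtype.val h) }
  have hH : ∀ S : Set U, S.Nonempty → S ≠ Set.univ → lam ≤ (H.cutEdges S).ncard := by
    classical
    intro S hne hS
    have h1 := hcut ((univ.filter (· ∈ S)).map (Function.Embedding.subtype _))
      (fun x hx => by
        simp only [mem_map] at hx
        obtain ⟨y, -, rfl⟩ := hx
        exact y.2)
      (by
        obtain ⟨s, hs⟩ := hne
        exact ⟨s, mem_map_of_mem _ (by simpa using hs)⟩)
      (fun hU => hS (Set.eq_univ_of_forall fun y => by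
        have hy : (y : V) ∈ (univ.filter (· ∈ S)).map (Function.Embedding.subtype _) :=
          hU.symm ▸ y.2
        simpa using hy))
    refine h1.trans ?_
    rw [← Set.ncard_coe_finset, ← Set.ncard_image_of_injective _ Subtype.val_injective]
    refine Set.ncard_le_ncard ?_ (Set.toFinite _)
    intro e he
    simp only [cut, coe_filter, Set.mem_ofPred_eq] at he
    refine ⟨⟨e, he.1⟩, ?_, rfl⟩
    have h2 := he.2
    have h3 := hF e he.1
    simp only [mem_map, mem_filter, mem_univ, true_and, Function.Embedding.subtype_apply,
      Subtype.exists, exists_and_right, exists_eq_right, h3.1, h3.2.1, exists_true_left] at h2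
    simp only [Multigraph.cutEdges, Set.mem_ofPred_eq, H]
    tauto
  obtain ⟨o, ho⟩ := hyp U F H ⟨⟨fun _ _ => ⟨trivial, trivial⟩, fun u _ v _ =>
    reflTransGen_of_cut H (fun S hne hS =>
      Set.nonempty_of_ncard_ne_zero (by have := hH S hne hS; omega)) u v⟩, hH⟩ (fun u => f u) (by
      rw [Nat.card_eq_fintype_card, Fintype.card_coe, hf, ← sum_coe_sort U])
  refine ⟨fun e => if he : e ∈ F then o ⟨e, he⟩ else true, fun u hu => ?_⟩
  refine Eq.trans ?_ (ho ⟨u, hu⟩)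
  congr 1
  unfold outCount Multigraph.outDeg Multigraph.outDegOn
  rw [← Set.ncard_coe_finset, ← Set.ncard_image_of_injective _ Subtype.val_injective]
  congr 1
  ext e
  simp only [coe_filter, Set.mem_ofPred_eq, Set.mem_univ, true_and, Set.mem_image, Subtype.exists,
    exists_and_right, exists_eq_right, Multigraph.tail, H]
  constructor
  · rintro ⟨he, h⟩
    refine ⟨he, ?_⟩
    simp only [dif_pos he] at h
    split_ifs at h ⊢ <;> exact Subtype.ext h
  · rintro ⟨he, h⟩
    refine ⟨he, ?_⟩
    simp only [dif_pos he]
    split_ifs at h ⊢ <;> exact congrArg Subtype.val h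

theorem IsPacking.orientable {k lam : ℕ} (hk : 0 < k) (hlam : k + 2 ≤ lam)
    (hyp : ∀ (W F : Type) [Fintype W] [Fintype F] (H : Multigraph W F),
      H.EdgeConnected lam →
        ∀ g : W → ZMod k, (Nat.card F : ZMod k) = ∑ w, g w →
          ∃ o : F → Bool, H.IsModOrientation k g o)
    {p q : E → V} {U : Finset V} {F : Finset E} {T : Fin (lam - 2) → Finset E}
    (h : IsPacking p q U F T) : Orientable k p q U F := by
  induction hn : #U using Nat.strong_induction_on generalizing p q U F T with
  | _ n ih =>
    subst hn
    have ih' : ∀ (p q : E → V) (U' : Finset V) (F : Finset E) (T : Fin (lam - 2) → Finset E),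
        #U' < #U → IsPacking p q U' F T → Orientable k p q U' F :=
      fun p q U' F T hlt h => ih _ hlt h rfl
    by_cases hcut : ∀ S ⊆ U, S.Nonempty → S ≠ U → lam ≤ #(cut p q F S)
    · exact orientable_of_cut (by omega) hyp h.ends hcut
    push Not at hcut
    obtain ⟨A, hA, hne, hAU, hlt⟩ := hcut
    have hlt' : #(cut p q F A) < lam - 2 + 2 := by omega
    obtain hc | hc := h.inside_connected hA hne hAU hlt'
    · exact h.orientable_of_small_cut hk (by omega) ih' hA hne hAU hlt' hc
    · refine h.orientable_of_small_cut hk (by omega) ih' sdiff_subset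
        (sdiff_nonempty.2 fun hUA => hAU (hA.antisymm hUA)) (fun hU => ?_) ?_ hc
      · obtain ⟨a, ha⟩ := hne
        have := hA ha
        rw [← hU, mem_sdiff] at this
        exact this.2 ha
      · rwa [cut_sdiff fun e he => ⟨(h.ends e he).1, (h.ends e he).2.1⟩]

lemma cutConnected_of_connectedOn [Fintype V] (G : Multigraph V E) {T : Finset E}
    (h : G.ConnectedOn T) : CutConnected G.fst G.snd univ T := by
  rintro S - ⟨s, hs⟩ hSU
  by_contra! hcon
  refine hSU (eq_univ_of_forall fun v => ?_)
  have := h.2 s trivial v trivial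
  induction this with
  | refl => exact hs
  | tail _ hadj ih =>
    obtain ⟨e, he, ⟨rfl, rfl⟩ | ⟨rfl, rfl⟩⟩ := hadj
    · exact (hcon e he).1 ih
    · exact (hcon e he).2 ih

end EdgePacking

/-- main theorem: let `k ≥ 3` and `λ ≥ k + 2` be such that every
`λ`-edge-connected graph `H` admits a `g`-orientation for every `g` with
`|E(H)| ≡ ∑ g (mod k)`. If `G` contains `λ - 2` pairwise edge-disjoint spanning
trees and `|E(G)| ≡ ∑ v, f v (mod k)`, then `G` has an `f`-orientation. -/
theorem mod_orientation_of_edge_disjoint_spanning_trees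
    (k lam : ℕ) (hk : 3 ≤ k) (hlam : k + 2 ≤ lam)
    (hyp : ∀ (W F : Type) [Fintype W] [Fintype F] (H : Multigraph W F),
      H.EdgeConnected lam →
        ∀ g : W → ZMod k, (Nat.card F : ZMod k) = ∑ w, g w →
          ∃ o : F → Bool, H.IsModOrientation k g o)
    {V E : Type} [Fintype V] [Fintype E] (G : Multigraph V E)
    (hG : G.HasEdgeDisjointSpanningTrees (lam - 2))
    (f : V → ZMod k) (hf : (Nat.card E : ZMod k) = ∑ v, f v) :
    ∃ o : E → Bool, G.IsModOrientation k f o := by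
  classical
  obtain ⟨T, hT, hdisj⟩ := hG
  have hpack : EdgePacking.IsPacking G.fst G.snd Finset.univ Finset.univ
      (fun i => (T i).toFinset) :=
    { ends := fun e _ => ⟨Finset.mem_univ _, Finset.mem_univ _, G.loopless e⟩
      subset := fun _ => Finset.subset_univ _
      disjoint := fun i j hij => Set.disjoint_toFinset.2 (hdisj i j hij)
      connected := fun i => EdgePacking.cutConnected_of_connectedOn G
        (by rw [Set.coe_toFinset]; exact (hT i).1) }
  obtain ⟨o, ho⟩ := hpack.orientable (by omega) hlam hyp f (by
    rw [Finset.card_univ, ← Nat.card_eq_fintype_card, hf])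
  refine ⟨o, fun v => ?_⟩
  rw [← ho v (Finset.mem_univ v)]
  congr 1
  unfold EdgePacking.outCount Multigraph.outDeg Multigraph.outDegOn
  rw [← Set.ncard_coe_finset]
  congr 1
  ext e
  simp [Multigraph.tail]
end

section
/- Let k ≥ 3 and r ≥ 0 be integers, and let λ be an integer with λ ≥ k+2 such that every λ-edge-connected graph H admits a g-orientation for every mapping g : V(H) → Z_k with |E(H)| ≡ Σ_{v∈V(H)} g(v) (mod k). If G is a bipartite graph with parts A₁ and A₂ that contains 2r+λ−2 pairwise edge-disjoint spanning trees and |E(G)| is divisible by k, then the edge set of G can be partitioned into two spanning subgraphs G₁ and G₂ such that each G_i contains r pairwise edge-disjoint spanning trees and the degree in G_i of every vertex of A_i is divisible by k. -/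
namespace Multigraph

open Classical

variable {V E : Type}

/-- The edge `e` joins `u` and `v`. -/
def Joins (G : Multigraph V E) (e : E) (u v : V) : Prop :=
  (G.fst e = u ∧ G.snd e = v) ∨ (G.fst e = v ∧ G.snd e = u)

/-- `t` selects an endpoint of every edge in `F`. -/
def IsTailMap (G : Multigraph V E) (F : Finset E) (t : E → V) : Prop :=
  ∀ e ∈ F, t e = G.fst e ∨ t e = G.snd e

/-- The number, modulo `k`, of edges in `F` whose selected endpoint is `v`. -/
noncomputable def tailCount (k : ℕ) (F : Finset E) (t : E → V) (v : V) : ZMod k :=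
  ∑ e ∈ F, if t e = v then 1 else 0

/-- Every choice of out-degrees modulo `k` on `S` is realised by orienting `F`. -/
def FreelyOrientable (k : ℕ) (G : Multigraph V E) (S : Finset V) (F : Finset E) : Prop :=
  ∀ g : V → ZMod k, ∃ t, G.IsTailMap F t ∧ ∀ v ∈ S, tailCount k F t v = g v

/-- Every choice of out-degrees modulo `k` on `S` with sum `|F|` is realised by orienting `F`. -/
def Orientable (k : ℕ) (G : Multigraph V E) (S : Finset V) (F : Finset E) : Prop :=
  ∀ g : V → ZMod k, (F.card : ZMod k) = ∑ v ∈ S, g v →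
    ∃ t, G.IsTailMap F t ∧ ∀ v ∈ S, tailCount k F t v = g v

/-- The edge set `T` connects all vertices of `S`. -/
def Connects (G : Multigraph V E) (T : Finset E) (S : Finset V) : Prop :=
  ∀ u ∈ S, ∀ v ∈ S, Relation.ReflTransGen (G.AdjOn (T : Set E)) u v

/-- `F` contains `m` pairwise disjoint edge sets, each connecting all of `S`. -/
def HasConnectedPacking (G : Multigraph V E) (S : Finset V) (F : Finset E) (m : ℕ) : Prop :=
  ∃ T : Fin m → Finset E, (∀ i, T i ⊆ F) ∧ (∀ i j, i ≠ j → Disjoint (T i) (T j)) ∧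
    ∀ i, G.Connects (T i) S

/-- The edges of `F` with both endpoints in `X`. -/
noncomputable def inner (G : Multigraph V E) (F : Finset E) (X : Finset V) : Finset E :=
  F.filter fun e => G.fst e ∈ X ∧ G.snd e ∈ X

/-- The edges of `F` between `X` and `Y`. -/
noncomputable def between (G : Multigraph V E) (F : Finset E) (X Y : Finset V) : Finset E :=
  F.filter fun e => (G.fst e ∈ X ∧ G.snd e ∈ Y) ∨ (G.fst e ∈ Y ∧ G.snd e ∈ X)

theorem mem_inner {G : Multigraph V E} {F : Finset E} {X : Finset V} {e : E} :
    e ∈ G.inner F X ↔ e ∈ F ∧ G.fst e ∈ X ∧ G.snd e ∈ X := by simp [inner]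

theorem mem_between {G : Multigraph V E} {F : Finset E} {X Y : Finset V} {e : E} :
    e ∈ G.between F X Y ↔
      e ∈ F ∧ ((G.fst e ∈ X ∧ G.snd e ∈ Y) ∨ (G.fst e ∈ Y ∧ G.snd e ∈ X)) := by simp [between]

theorem between_comm (G : Multigraph V E) (F : Finset E) (X Y : Finset V) :
    G.between F X Y = G.between F Y X := by
  ext e; simp only [mem_between]; tauto

theorem inner_union_between_union_inner {G : Multigraph V E} {F : Finset E} {X Y : Finset V}
    (hF : ∀ e ∈ F, G.fst e ∈ X ∪ Y ∧ G.snd e ∈ X ∪ Y) :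
    (G.inner F X ∪ G.between F X Y) ∪ G.inner F Y = F := by
  ext e
  have := hF e
  simp only [Finset.mem_union, mem_inner, mem_between] at *
  tauto

theorem tailCount_congr {k : ℕ} {F : Finset E} {s t : E → V} (h : ∀ e ∈ F, s e = t e) (v : V) :
    tailCount k F s v = tailCount k F t v :=
  Finset.sum_congr rfl fun e he => by rw [h e he]

theorem tailCount_union {k : ℕ} {A B : Finset E} (h : Disjoint A B) (t : E → V) (v : V) :
    tailCount k (A ∪ B) t v = tailCount k A t v + tailCount k B t v :=
  Finset.sum_union h

theorem tailCount_insert {k : ℕ} {F : Finset E} {e : E} (h : e ∉ F) (t : E → V) (v : V) :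
    tailCount k (insert e F) t v = (if t e = v then 1 else 0) + tailCount k F t v :=
  Finset.sum_insert h

theorem sum_tailCount (k : ℕ) (F : Finset E) (t : E → V) (S : Finset V) :
    ∑ v ∈ S, tailCount k F t v = ((F.filter fun e => t e ∈ S).card : ZMod k) := by
  unfold tailCount
  rw [Finset.sum_comm]
  simp

theorem IsTailMap.sum_tailCount {k : ℕ} {G : Multigraph V E} {F : Finset E} {t : E → V}
    {S : Finset V} (ht : G.IsTailMap F t) (hF : ∀ e ∈ F, G.fst e ∈ S ∧ G.snd e ∈ S) :
    ∑ v ∈ S, tailCount k F t v = (F.card : ZMod k) := by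
  rw [Multigraph.sum_tailCount, Finset.filter_true_of_mem]
  intro e he
  rcases ht e he with h | h <;> rw [h]
  exacts [(hF e he).1, (hF e he).2]

theorem IsTailMap.piecewise {G : Multigraph V E} {A B : Finset E} {s t : E → V}
    (hs : G.IsTailMap A s) (ht : G.IsTailMap B t) :
    G.IsTailMap (A ∪ B) (fun e => if e ∈ A then s e else t e) := by
  intro e he
  by_cases h : e ∈ A
  · simpa [h] using hs e h
  · simpa [h] using ht e ((Finset.mem_union.1 he).resolve_left h)

theorem tailCount_piecewise {k : ℕ} {A B : Finset E} (h : Disjoint A B) (s t : E → V) (v : V) :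
    tailCount k (A ∪ B) (fun e => if e ∈ A then s e else t e) v =
      tailCount k A s v + tailCount k B t v := by
  rw [tailCount_union h]
  congr 1
  · exact tailCount_congr (fun e he => by simp [he]) v
  · exact tailCount_congr (fun e he => by simp [Finset.disjoint_right.1 h he]) v

theorem Orientable.freelyOrientable {k : ℕ} (hk : 0 < k) {G : Multigraph V E} {X : Finset V}
    {A C : Finset E} (hA : G.Orientable k X A) (hAC : Disjoint A C)
    (hC : ∀ e ∈ C, ∃ a ∈ X, ∃ b, b ∉ X ∧ G.Joins e a b) (hcard : k ≤ C.card + 1) :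
    G.FreelyOrientable k X (C ∪ A) := by
  intro g
  have : NeZero k := ⟨hk.ne'⟩
  set a : ZMod k := ∑ v ∈ X, g v - (A.card : ZMod k) with ha
  obtain ⟨D, hDC, hD⟩ : ∃ D ⊆ C, D.card = a.val :=
    Finset.exists_subset_card_eq (by have := ZMod.val_lt a; omega)
  have hs : ∀ e, ∃ w, e ∈ C → (w = G.fst e ∨ w = G.snd e) ∧ (w ∈ X ↔ e ∈ D) := by
    intro e
    by_cases he : e ∈ C
    · obtain ⟨a, ha, b, hb, hj⟩ := hC e he
      by_cases hd : e ∈ D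
      · exact ⟨a, fun _ => ⟨by rcases hj with ⟨h, h'⟩ | ⟨h, h'⟩ <;> simp [h, h'], by simp [ha, hd]⟩⟩
      · exact ⟨b, fun _ => ⟨by rcases hj with ⟨h, h'⟩ | ⟨h, h'⟩ <;> simp [h, h'], by simp [hb, hd]⟩⟩
    · exact ⟨G.fst e, fun h => absurd h he⟩
  choose s hs using hs
  have hsum : ∑ v ∈ X, tailCount k C s v = a := by
    rw [sum_tailCount, show (C.filter fun e => s e ∈ X) = D from ?_, hD, ZMod.natCast_zmod_val]
    ext e
    simp only [Finset.mem_filter]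
    exact ⟨fun h => ((hs e h.1).2).1 h.2, fun h => ⟨hDC h, ((hs e (hDC h)).2).2 h⟩⟩
  obtain ⟨t, ht, htg⟩ := hA (fun v => g v - tailCount k C s v) (by
    rw [Finset.sum_sub_distrib, hsum, ha]; ring)
  refine ⟨_, IsTailMap.piecewise (fun e he => (hs e he).1) ht, fun v hv => ?_⟩
  rw [tailCount_piecewise hAC.symm, htg v hv]
  ring

theorem FreelyOrientable.orientable_union {k : ℕ} {G : Multigraph V E} {X Y : Finset V}
    {A B : Finset E} (hA : G.FreelyOrientable k X A) (hB : G.Orientable k Y B)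
    (hXY : Disjoint X Y) (hAB : Disjoint A B)
    (hAe : ∀ e ∈ A, G.fst e ∈ X ∪ Y ∧ G.snd e ∈ X ∪ Y)
    (hBe : ∀ e ∈ B, G.fst e ∈ Y ∧ G.snd e ∈ Y) :
    G.Orientable k (X ∪ Y) (A ∪ B) := by
  intro g hg
  obtain ⟨s, hs, hsg⟩ := hA g
  have h1 := hs.sum_tailCount (k := k) hAe
  rw [Finset.sum_union hXY, Finset.sum_congr rfl hsg] at h1
  rw [Finset.sum_union hXY, Finset.card_union_of_disjoint hAB, Nat.cast_add] at hg
  obtain ⟨t, ht, htg⟩ := hB (fun v => g v - tailCount k A s v) (by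
    rw [Finset.sum_sub_distrib]; linear_combination hg + h1)
  refine ⟨_, hs.piecewise ht, fun v hv => ?_⟩
  rw [tailCount_piecewise hAB]
  rcases Finset.mem_union.1 hv with hv | hv
  · rw [hsg v hv, add_eq_left]
    refine Finset.sum_eq_zero fun e he => if_neg ?_
    rintro rfl
    refine Finset.disjoint_left.1 hXY hv ?_
    rcases ht e he with h | h <;> rw [h]
    exacts [(hBe e he).1, (hBe e he).2]
  · rw [htg v hv]; ring

/-- The multigraph obtained from `G` by moving the edge `e` so that it joins `u` and `v`. -/
noncomputable def moveEdge (G : Multigraph V E) (e : E) (u v : V) (h : u ≠ v) :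
    Multigraph V E where
  fst := Function.update G.fst e u
  snd := Function.update G.snd e v
  loopless e' := by
    by_cases he : e' = e
    · subst he; simpa
    · simpa [he] using G.loopless e'

theorem FreelyOrientable.of_moveEdge {k : ℕ} {G : Multigraph V E} {X : Finset V} {A : Finset E}
    {e₁ e₂ : E} {u₁ u₂ x₁ x₂ : V} (hu : u₁ ≠ u₂) (hx₁ : x₁ ∉ X) (hx₂ : x₂ ∉ X)
    (hj₁ : G.Joins e₁ u₁ x₁) (hj₂ : G.Joins e₂ u₂ x₂) (hA₁ : e₁ ∉ A) (hA₂ : e₂ ∉ A)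
    (he : e₁ ≠ e₂) (h : (G.moveEdge e₁ u₁ u₂ hu).FreelyOrientable k X (insert e₁ A)) :
    G.FreelyOrientable k X (insert e₁ (insert e₂ A)) := by
  intro g
  obtain ⟨t, ht, htg⟩ := h g
  have ht₁ : t e₁ = u₁ ∨ t e₁ = u₂ := by
    simpa [moveEdge] using ht e₁ (Finset.mem_insert_self _ _)
  set s : E → V := fun e => if e = e₁ then (if t e₁ = u₁ then u₁ else x₁) else
    if e = e₂ then (if t e₁ = u₁ then x₂ else u₂) else t e with hs
  have hs₁ : s e₁ = if t e₁ = u₁ then u₁ else x₁ := by simp [hs]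
  have hs₂ : s e₂ = if t e₁ = u₁ then x₂ else u₂ := by simp [hs, he.symm]
  have hsA : ∀ e ∈ A, s e = t e := fun e hA => by
    have h1 : e ≠ e₁ := fun h => hA₁ (h ▸ hA)
    have h2 : e ≠ e₂ := fun h => hA₂ (h ▸ hA)
    simp [hs, h1, h2]
  refine ⟨s, ?_, fun v hv => ?_⟩
  · intro e hmem
    rcases Finset.mem_insert.1 hmem with rfl | hmem
    · rw [hs₁]; rcases hj₁ with ⟨h, h'⟩ | ⟨h, h'⟩ <;> split_ifs <;> simp [h, h']
    rcases Finset.mem_insert.1 hmem with rfl | hmem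
    · rw [hs₂]; rcases hj₂ with ⟨h, h'⟩ | ⟨h, h'⟩ <;> split_ifs <;> simp [h, h']
    · rw [hsA e hmem]
      have h1 : e ≠ e₁ := fun h => hA₁ (h ▸ hmem)
      simpa [moveEdge, h1] using ht e (Finset.mem_insert_of_mem hmem)
  · have h1 : x₁ ≠ v := fun h => hx₁ (h ▸ hv)
    have h2 : x₂ ≠ v := fun h => hx₂ (h ▸ hv)
    rw [← htg v hv, tailCount_insert hA₁, tailCount_insert (by simp [he, hA₁]),
      tailCount_insert hA₂, tailCount_congr hsA, hs₁, hs₂]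
    rcases ht₁ with h | h
    · simp [h, h2]
    · simp [h, hu.symm, h1]

theorem AdjOn.symm {G : Multigraph V E} {F : Set E} {u v : V} (h : G.AdjOn F u v) :
    G.AdjOn F v u := by
  obtain ⟨e, he, h⟩ := h
  exact ⟨e, he, h.symm⟩

theorem equivalence_reflTransGen_adjOn (G : Multigraph V E) (F : Set E) :
    Equivalence (Relation.ReflTransGen (G.AdjOn F)) :=
  have : Std.Symm (G.AdjOn F) := ⟨fun _ _ => AdjOn.symm⟩
  ⟨fun _ => .refl, fun h => Relation.ReflTransGen.stdSymm.symm _ _ h, fun h h' => h.trans h'⟩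

theorem mem_of_reflTransGen_adjOn {G : Multigraph V E} {F : Set E} {Z : Set V}
    (hZ : ∀ u ∈ Z, ∀ v, G.AdjOn F u v → v ∈ Z) {u v : V}
    (h : Relation.ReflTransGen (G.AdjOn F) u v) (hu : u ∈ Z) : v ∈ Z := by
  induction h with
  | refl => exact hu
  | tail _ h ih => exact hZ _ ih _ h

theorem rel_of_reflTransGen_adjOn {G : Multigraph V E} {F : Set E} {X : Finset V}
    {R : V → V → Prop} (hR : Equivalence R) (p : V)
    (hin : ∀ e ∈ F, ∀ a ∈ X, ∀ b ∈ X, G.Joins e a b → R a b)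
    (hcross : ∀ e ∈ F, ∀ a ∈ X, ∀ b, b ∉ X → G.Joins e a b → R a p) {u v : V}
    (h : Relation.ReflTransGen (G.AdjOn F) u v) (hu : u ∈ X) (hv : v ∈ X) : R u v := by
  have key : R (if u ∈ X then u else p) (if v ∈ X then v else p) := by
    clear hv
    induction h with
    | refl => exact hR.refl _
    | @tail b c _ hbc ih =>
      refine hR.trans ih ?_
      obtain ⟨e, he, hj⟩ := hbc
      by_cases hb : b ∈ X <;> by_cases hc : c ∈ X <;> simp only [hb, hc, if_true, if_false]
      · exact hin e he b hb c hc hj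
      · exact hcross e he b hb c hc hj
      · exact hR.symm (hcross e he c hc b hb hj.symm)
      · exact hR.refl _
  simpa [hu, hv] using key

theorem reflTransGen_inner {G : Multigraph V E} {T : Finset E} {X : Finset V} (p : V)
    (hcross : ∀ e ∈ T, ∀ a ∈ X, ∀ b, b ∉ X → G.Joins e a b →
      Relation.ReflTransGen (G.AdjOn (G.inner T X : Set E)) a p) {u v : V}
    (h : Relation.ReflTransGen (G.AdjOn (T : Set E)) u v) (hu : u ∈ X) (hv : v ∈ X) :
    Relation.ReflTransGen (G.AdjOn (G.inner T X : Set E)) u v := by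
  refine rel_of_reflTransGen_adjOn (G.equivalence_reflTransGen_adjOn _) p ?_ hcross h hu hv
  intro e he a ha b hb hj
  refine .single ⟨e, mem_inner.2 ⟨he, ?_⟩, hj⟩
  rcases hj with ⟨rfl, rfl⟩ | ⟨rfl, rfl⟩
  exacts [⟨ha, hb⟩, ⟨hb, ha⟩]

theorem Joins.mem_between {G : Multigraph V E} {T : Finset E} {X Y : Finset V} {e : E} {a b : V}
    (hj : G.Joins e a b) (he : e ∈ T) (ha : a ∈ X) (hb : b ∈ Y) : e ∈ G.between T X Y := by
  refine Multigraph.mem_between.2 ⟨he, ?_⟩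
  rcases hj with ⟨rfl, rfl⟩ | ⟨rfl, rfl⟩
  exacts [.inl ⟨ha, hb⟩, .inr ⟨hb, ha⟩]

theorem exists_joins_of_mem_between {G : Multigraph V E} {T : Finset E} {X Y : Finset V} {e : E}
    (he : e ∈ G.between T X Y) : ∃ a ∈ X, ∃ b ∈ Y, G.Joins e a b := by
  rcases (mem_between.1 he).2 with h | h
  exacts [⟨_, h.1, _, h.2, .inl ⟨rfl, rfl⟩⟩, ⟨_, h.2, _, h.1, .inr ⟨rfl, rfl⟩⟩]

theorem Joins.mem_right {G : Multigraph V E} {X Y : Finset V} {e : E} {a b : V}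
    (hj : G.Joins e a b) (he : G.fst e ∈ X ∪ Y ∧ G.snd e ∈ X ∪ Y) (hb : b ∉ X) : b ∈ Y := by
  rcases hj with ⟨rfl, rfl⟩ | ⟨rfl, rfl⟩
  exacts [(Finset.mem_union.1 he.2).resolve_left hb, (Finset.mem_union.1 he.1).resolve_left hb]

theorem Joins.eq_left {G : Multigraph V E} {X : Finset V} {e : E} {a b a' b' : V}
    (hj : G.Joins e a b) (hj' : G.Joins e a' b') (ha : a ∈ X) (hb' : b' ∉ X) : a = a' := by
  rcases hj with ⟨rfl, rfl⟩ | ⟨rfl, rfl⟩ <;> rcases hj' with ⟨rfl, rfl⟩ | ⟨rfl, rfl⟩ <;>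
    first | rfl | exact absurd ha hb'

section TwoParts

variable {G : Multigraph V E} {X Y : Finset V} {T F : Finset E}

theorem Connects.inner_of_forall_mem_between (hT : ∀ e ∈ T, G.fst e ∈ X ∪ Y ∧ G.snd e ∈ X ∪ Y)
    (hconn : G.Connects T (X ∪ Y)) (p : V)
    (hp : ∀ e ∈ G.between T X Y, ∀ a ∈ X, ∀ b ∈ Y, G.Joins e a b →
      Relation.ReflTransGen (G.AdjOn (G.inner T X : Set E)) a p) :
    G.Connects (G.inner T X) X := by
  intro u hu v hv
  refine reflTransGen_inner p ?_
    (hconn u (Finset.mem_union_left _ hu) v (Finset.mem_union_left _ hv)) hu hv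
  intro e he a ha b hb hj
  have hbY := hj.mem_right (hT e he) hb
  exact hp e (hj.mem_between he ha hbY) a ha b hbY hj

theorem Connects.inner_of_between_eq_singleton (hXY : Disjoint X Y)
    (hT : ∀ e ∈ T, G.fst e ∈ X ∪ Y ∧ G.snd e ∈ X ∪ Y)
    (hconn : G.Connects T (X ∪ Y)) {c : E} (hc : G.between T X Y = {c}) :
    G.Connects (G.inner T X) X := by
  obtain ⟨p, -, q, hq, hj⟩ := exists_joins_of_mem_between (hc ▸ Finset.mem_singleton_self c)
  refine hconn.inner_of_forall_mem_between hT p fun e he a ha b _ hj' => ?_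
  rw [hc, Finset.mem_singleton] at he
  subst he
  rw [hj'.eq_left hj ha (Finset.disjoint_right.1 hXY hq)]

theorem Connects.inner_of_between_eq_pair (hXY : Disjoint X Y)
    (hT : ∀ e ∈ T, G.fst e ∈ X ∪ Y ∧ G.snd e ∈ X ∪ Y)
    (hconn : G.Connects T (X ∪ Y)) {e₁ e₂ : E} (he : G.between T X Y = {e₁, e₂})
    {u₁ u₂ x₁ x₂ : V} (hj₁ : G.Joins e₁ u₁ x₁) (hj₂ : G.Joins e₂ u₂ x₂) (hx₁ : x₁ ∈ Y)
    (hx₂ : x₂ ∈ Y) (hu : Relation.ReflTransGen (G.AdjOn (G.inner T X : Set E)) u₁ u₂) :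
    G.Connects (G.inner T X) X := by
  refine hconn.inner_of_forall_mem_between hT u₁ fun e he' a ha b _ hj' => ?_
  rw [he, Finset.mem_insert, Finset.mem_singleton] at he'
  rcases he' with rfl | rfl
  · rw [hj'.eq_left hj₁ ha (Finset.disjoint_right.1 hXY hx₁)]
  · rw [hj'.eq_left hj₂ ha (Finset.disjoint_right.1 hXY hx₂)]
    exact (G.equivalence_reflTransGen_adjOn _).symm hu

theorem Joins.mem_inner {e : E} {a b : V} (hj : G.Joins e a b) (he : e ∈ T) (ha : a ∈ X)
    (hb : b ∈ X) : e ∈ G.inner T X := by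
  refine Multigraph.mem_inner.2 ⟨he, ?_⟩
  rcases hj with ⟨rfl, rfl⟩ | ⟨rfl, rfl⟩
  exacts [⟨ha, hb⟩, ⟨hb, ha⟩]

theorem Joins.symm {e : E} {a b : V} (hj : G.Joins e a b) : G.Joins e b a := Or.symm hj

theorem Connects.inner_or_inner_of_between_eq_pair (hXY : Disjoint X Y)
    (hT : ∀ e ∈ T, G.fst e ∈ X ∪ Y ∧ G.snd e ∈ X ∪ Y)
    (hconn : G.Connects T (X ∪ Y)) {e₁ e₂ : E} (he : G.between T X Y = {e₁, e₂}) :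
    G.Connects (G.inner T X) X ∨ G.Connects (G.inner T Y) Y := by
  obtain ⟨u₁, hu₁, x₁, hx₁, hj₁⟩ := exists_joins_of_mem_between (e := e₁) (by rw [he]; simp)
  obtain ⟨u₂, hu₂, x₂, hx₂, hj₂⟩ := exists_joins_of_mem_between (e := e₂) (by rw [he]; simp)
  by_cases hu : Relation.ReflTransGen (G.AdjOn (G.inner T X : Set E)) u₁ u₂
  · exact .inl (hconn.inner_of_between_eq_pair hXY hT he hj₁ hj₂ hx₁ hx₂ hu)
  by_cases hx : Relation.ReflTransGen (G.AdjOn (G.inner T Y : Set E)) x₁ x₂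
  · rw [Finset.union_comm] at hT hconn
    rw [between_comm] at he
    exact .inr (hconn.inner_of_between_eq_pair hXY.symm hT he hj₁.symm hj₂.symm hu₁ hu₂ hx)
  exfalso
  have hXn : ∀ {w}, w ∈ X → w ∉ Y := fun h => Finset.disjoint_left.1 hXY h
  have hYn : ∀ {w}, w ∈ Y → w ∉ X := fun h => Finset.disjoint_right.1 hXY h
  have hmem : u₂ ∈ {w | (w ∈ X ∧ Relation.ReflTransGen (G.AdjOn (G.inner T X : Set E)) u₁ w) ∨
      (w ∈ Y ∧ Relation.ReflTransGen (G.AdjOn (G.inner T Y : Set E)) x₁ w)} := by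
    refine mem_of_reflTransGen_adjOn ?_ (hconn u₁ (Finset.mem_union_left _ hu₁) u₂
      (Finset.mem_union_left _ hu₂)) (.inl ⟨hu₁, .refl⟩)
    rintro u hu v ⟨e, heT, hj⟩
    have hj : G.Joins e u v := hj
    rcases hu with ⟨huX, hu⟩ | ⟨huY, hu⟩
    · by_cases hv : v ∈ X
      · exact .inl ⟨hv, hu.tail ⟨e, hj.mem_inner heT huX hv, hj⟩⟩
      · have hvY := hj.mem_right (hT e heT) hv
        have he' := hj.mem_between heT huX hvY
        rw [he, Finset.mem_insert, Finset.mem_singleton] at he'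
        rcases he' with rfl | rfl
        · rw [hj.symm.eq_left hj₁.symm hvY (hXn hu₁)]
          exact .inr ⟨hx₁, .refl⟩
        · exact absurd (hj.eq_left hj₂ huX (hYn hx₂) ▸ hu) ‹_›
    · by_cases hv : v ∈ Y
      · exact .inr ⟨hv, hu.tail ⟨e, hj.mem_inner heT huY hv, hj⟩⟩
      · have hvX := hj.mem_right (Finset.union_comm X Y ▸ hT e heT) hv
        have he' := hj.symm.mem_between heT hvX huY
        rw [he, Finset.mem_insert, Finset.mem_singleton] at he'
        rcases he' with rfl | rfl
        · rw [hj.symm.eq_left hj₁ hvX (hYn hx₁)]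
          exact .inl ⟨hu₁, .refl⟩
        · exact absurd (hj.eq_left hj₂.symm huY (hXn hu₂) ▸ hu) ‹_›
  rcases hmem with ⟨-, h⟩ | ⟨h, -⟩
  · exact hu h
  · exact hXn hu₂ h

theorem Connects.between_nonempty (hX : X.Nonempty) (hY : Y.Nonempty) (hXY : Disjoint X Y)
    (hT : ∀ e ∈ T, G.fst e ∈ X ∪ Y ∧ G.snd e ∈ X ∪ Y) (hconn : G.Connects T (X ∪ Y)) :
    (G.between T X Y).Nonempty := by
  obtain ⟨x, hx⟩ := hX
  obtain ⟨y, hy⟩ := hY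
  by_contra hne
  refine Finset.disjoint_right.1 hXY hy (mem_of_reflTransGen_adjOn (Z := (X : Set V)) ?_
    (hconn x (Finset.mem_union_left _ hx) y (Finset.mem_union_right _ hy)) hx)
  rintro u hu v ⟨e, he, hj⟩
  have hj : G.Joins e u v := hj
  by_contra hv
  exact hne ⟨e, hj.mem_between he hu (hj.mem_right (hT e he) hv)⟩

theorem hasConnectedPacking_inner {m : ℕ} {T : Fin m → Finset E} (hTF : ∀ i, T i ⊆ F)
    (hdis : ∀ i j, i ≠ j → Disjoint (T i) (T j)) (hX : ∀ i, G.Connects (G.inner (T i) X) X) :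
    G.HasConnectedPacking X (G.inner F X) m :=
  ⟨fun i => G.inner (T i) X,
    fun i _ he => mem_inner.2 ⟨hTF i (mem_inner.1 he).1, (mem_inner.1 he).2⟩,
    fun i j hij => Finset.disjoint_left.2 fun _ h h' =>
      Finset.disjoint_left.1 (hdis i j hij) (mem_inner.1 h).1 (mem_inner.1 h').1, hX⟩

theorem disjoint_inner_between (hXY : Disjoint X Y) :
    Disjoint (G.inner F X) (G.between F X Y) := by
  refine Finset.disjoint_left.2 fun e h h' => ?_
  rcases (mem_between.1 h').2 with h'' | h''
  · exact Finset.disjoint_left.1 hXY (mem_inner.1 h).2.2 h''.2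
  · exact Finset.disjoint_left.1 hXY (mem_inner.1 h).2.1 h''.1

theorem Orientable.freelyOrientable_between {k : ℕ} (hk : 0 < k) (hXY : Disjoint X Y)
    (h : G.Orientable k X (G.inner F X)) (hcard : k ≤ (G.between F X Y).card + 1) :
    G.FreelyOrientable k X (G.between F X Y ∪ G.inner F X) := by
  refine h.freelyOrientable hk (disjoint_inner_between hXY) (fun e he => ?_) hcard
  obtain ⟨a, ha, b, hb, hj⟩ := exists_joins_of_mem_between he
  exact ⟨a, ha, b, Finset.disjoint_right.1 hXY hb, hj⟩

theorem FreelyOrientable.orientable {k : ℕ} (hXY : Disjoint X Y)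
    (hF : ∀ e ∈ F, G.fst e ∈ X ∪ Y ∧ G.snd e ∈ X ∪ Y)
    (hX : G.FreelyOrientable k X (G.between F X Y ∪ G.inner F X))
    (hY : G.Orientable k Y (G.inner F Y)) : G.Orientable k (X ∪ Y) F := by
  have hsub : ∀ e ∈ G.between F X Y ∪ G.inner F X, e ∈ F := fun e he => by
    rcases Finset.mem_union.1 he with h | h
    exacts [(mem_between.1 h).1, (mem_inner.1 h).1]
  have key := hX.orientable_union hY hXY ?_ (fun e he => hF e (hsub e he))
    fun e he => (mem_inner.1 he).2
  · have hu := inner_union_between_union_inner hF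
    rw [Finset.union_comm (G.inner F X)] at hu
    rwa [hu] at key
  · refine Finset.disjoint_left.2 fun e he he' => ?_
    rcases Finset.mem_union.1 he with h | h
    · rw [between_comm] at h
      exact Finset.disjoint_left.1 (disjoint_inner_between hXY.symm) he' h
    · exact Finset.disjoint_left.1 hXY (mem_inner.1 h).2.1 (mem_inner.1 he').2.1

theorem Joins.moveEdge {e e' : E} {a b u v : V} {huv : u ≠ v} (hj : G.Joins e' a b)
    (he : e' ≠ e) : (G.moveEdge e u v huv).Joins e' a b := by
  simpa [Joins, Multigraph.moveEdge, he] using hj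

theorem joins_moveEdge_self (G : Multigraph V E) (e : E) {u v : V} (huv : u ≠ v) :
    (G.moveEdge e u v huv).Joins e u v := by
  simp [Joins, Multigraph.moveEdge]

theorem freelyOrientable_of_between_eq_pair {k m : ℕ} (hk : 0 < k) (hXY : Disjoint X Y)
    (hF : ∀ e ∈ F, G.fst e ∈ X ∪ Y ∧ G.snd e ∈ X ∪ Y) {T : Fin m → Finset E}
    (hTF : ∀ i, T i ⊆ F) (hdis : ∀ i j, i ≠ j → Disjoint (T i) (T j))
    (hconn : ∀ i, G.Connects (T i) (X ∪ Y)) {j : Fin m} {e₁ e₂ : E} (hne : e₁ ≠ e₂)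
    (hej : G.between (T j) X Y = {e₁, e₂})
    (hTX : ∀ i, i ≠ j → G.Connects (G.inner (T i) X) X)
    (ih : ∀ (G' : Multigraph V E) (F' : Finset E), (∀ e ∈ F', G'.fst e ∈ X ∧ G'.snd e ∈ X) →
      G'.HasConnectedPacking X F' m → G'.Orientable k X F')
    (hcard : k + 1 ≤ (G.between F X Y).card) :
    G.FreelyOrientable k X (G.between F X Y ∪ G.inner F X) := by
  have hTe : ∀ i, ∀ e ∈ T i, G.fst e ∈ X ∪ Y ∧ G.snd e ∈ X ∪ Y := fun i e he => hF e (hTF i he)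
  have hm₁ : e₁ ∈ G.between (T j) X Y := by rw [hej]; simp
  have hm₂ : e₂ ∈ G.between (T j) X Y := by rw [hej]; simp
  obtain ⟨u₁, hu₁, x₁, hx₁, hj₁⟩ := exists_joins_of_mem_between hm₁
  obtain ⟨u₂, hu₂, x₂, hx₂, hj₂⟩ := exists_joins_of_mem_between hm₂
  have hx₁' := Finset.disjoint_right.1 hXY hx₁
  have hx₂' := Finset.disjoint_right.1 hXY hx₂
  have hT₁ : e₁ ∈ T j := (mem_between.1 hm₁).1
  have hT₂ : e₂ ∈ T j := (mem_between.1 hm₂).1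
  have hb₁ : e₁ ∈ G.between F X Y := hj₁.mem_between (hTF j hT₁) hu₁ hx₁
  have hb₂ : e₂ ∈ G.between F X Y := hj₂.mem_between (hTF j hT₂) hu₂ hx₂
  have hi₁ : e₁ ∉ G.inner F X := Finset.disjoint_right.1 (disjoint_inner_between hXY) hb₁
  have hi₂ : e₂ ∉ G.inner F X := Finset.disjoint_right.1 (disjoint_inner_between hXY) hb₂
  by_cases hu : u₁ = u₂
  · refine Orientable.freelyOrientable_between hk hXY (ih _ _ (fun e he => (mem_inner.1 he).2)
      (hasConnectedPacking_inner hTF hdis fun i => ?_)) (by omega)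
    by_cases hij : i = j
    · subst hij
      exact (hconn i).inner_of_between_eq_pair hXY (hTe i) hej hj₁ hj₂ hx₁ hx₂ (hu ▸ .refl)
    · exact hTX i hij
  set G' := G.moveEdge e₁ u₁ u₂ hu with hG'
  have hself : G'.Joins e₁ u₁ u₂ := joins_moveEdge_self G e₁ hu
  have hinner : G'.inner F X = insert e₁ (G.inner F X) := by
    ext e
    by_cases he : e = e₁
    · subst he
      simpa using hself.mem_inner (hTF j hT₁) hu₁ hu₂
    · simp [mem_inner, hG', Multigraph.moveEdge, he]
  have hpack : G'.HasConnectedPacking X (G'.inner F X) m := by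
    refine hasConnectedPacking_inner hTF hdis fun i => ?_
    by_cases hij : i = j
    · subst hij
      intro u hu' v hv
      refine rel_of_reflTransGen_adjOn (X := X) (G'.equivalence_reflTransGen_adjOn _) u₁ ?_ ?_
        (hconn i u (Finset.mem_union_left _ hu') v (Finset.mem_union_left _ hv)) hu' hv
      · intro e he a ha b hb hj
        have hee : e ≠ e₁ := by
          rintro rfl
          rcases hj with ⟨h, h'⟩ | ⟨h, h'⟩ <;> rcases hj₁ with ⟨h₁, h₂⟩ | ⟨h₁, h₂⟩
          exacts [hx₁' (h₂ ▸ h' ▸ hb), hx₁' (h₁ ▸ h ▸ ha), hx₁' (h₂ ▸ h' ▸ ha), hx₁' (h₁ ▸ h ▸ hb)]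
        have hj' := hj.moveEdge (u := u₁) (v := u₂) (huv := hu) hee
        exact .single ⟨e, hj'.mem_inner he ha hb, hj'⟩
      · intro e he a ha b hb hj
        have hmem := hj.mem_between he ha (hj.mem_right (hTe i e he) hb)
        rw [hej, Finset.mem_insert, Finset.mem_singleton] at hmem
        rcases hmem with rfl | rfl
        · rw [hj.eq_left hj₁ ha hx₁']
        · rw [hj.eq_left hj₂ ha hx₂']
          exact .single ⟨e₁, hself.mem_inner hT₁ hu₁ hu₂, hself.symm⟩
    · intro u hu' v hv
      refine Relation.ReflTransGen.mono ?_ _ _ (hTX i hij u hu' v hv)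
      rintro a b ⟨e, he, hj⟩
      have hee : e ≠ e₁ := by
        rintro rfl
        exact Finset.disjoint_left.1 (hdis i j hij) (mem_inner.1 he).1 hT₁
      have he' := mem_inner.1 he
      refine ⟨e, mem_inner.2 ⟨he'.1, ?_⟩, Joins.moveEdge hj hee⟩
      simpa [hG', Multigraph.moveEdge, hee] using he'.2
  have hori := ih G' _ (fun e he => (mem_inner.1 he).2) hpack
  rw [hinner] at hori
  set C := ((G.between F X Y).erase e₁).erase e₂ with hC
  have hCcard : k ≤ C.card + 1 := by
    rw [hC, Finset.card_erase_of_mem (Finset.mem_erase.2 ⟨hne.symm, hb₂⟩),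
      Finset.card_erase_of_mem hb₁]
    omega
  have hfree := hori.freelyOrientable hk (C := C) (by
      refine Finset.disjoint_left.2 fun e he he' => ?_
      simp only [hC, Finset.mem_erase] at he'
      rcases Finset.mem_insert.1 he with rfl | he
      · exact he'.2.1 rfl
      · exact Finset.disjoint_left.1 (disjoint_inner_between hXY) he he'.2.2) (by
      intro e he
      simp only [hC, Finset.mem_erase] at he
      obtain ⟨a, ha, b, hb, hj⟩ := exists_joins_of_mem_between he.2.2
      exact ⟨a, ha, b, Finset.disjoint_right.1 hXY hb, hj.moveEdge he.2.1⟩) hCcard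
  rw [Finset.union_insert] at hfree
  have := hfree.of_moveEdge hu hx₁' hx₂' hj₁ hj₂ (by simp [hC, hi₁]) (by simp [hC, hi₂]) hne
  convert this using 1
  rw [← Finset.insert_union, ← Finset.insert_union, hC,
    Finset.insert_erase (Finset.mem_erase.2 ⟨hne.symm, hb₂⟩), Finset.insert_erase hb₁]

theorem Orientable.of_forall_le_card_between {k lam : ℕ}
    (hyp : ∀ (W F : Type) [Fintype W] [Fintype F] (H : Multigraph W F),
      H.EdgeConnected lam →
        ∀ g : W → ZMod k, (Nat.card F : ZMod k) = ∑ w, g w →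
          ∃ o : F → Bool, H.IsModOrientation k g o) {S : Finset V}
    (hF : ∀ e ∈ F, G.fst e ∈ S ∧ G.snd e ∈ S) (hconn : G.Connects F S)
    (hcut : ∀ X Y, X.Nonempty → Y.Nonempty → Disjoint X Y → X ∪ Y = S →
      lam ≤ (G.between F X Y).card) : G.Orientable k S F := by
  let H : Multigraph S F := ⟨fun e => ⟨G.fst e, (hF e e.2).1⟩, fun e => ⟨G.snd e, (hF e e.2).2⟩,
    fun e h => G.loopless e (congrArg Subtype.val h)⟩
  have hH : H.EdgeConnected lam := by
    refine ⟨⟨fun _ _ => ⟨trivial, trivial⟩, ?_⟩, ?_⟩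
    · rintro ⟨u, hu⟩ - ⟨v, hv⟩ -
      have h := hconn u hu v hv
      induction h with
      | refl => exact .refl
      | @tail b c _ hbc ih =>
        obtain ⟨e, he, hj⟩ := hbc
        have hb : b ∈ S := by
          rcases hj with ⟨rfl, rfl⟩ | ⟨rfl, rfl⟩
          exacts [(hF e he).1, (hF e he).2]
        refine (ih hb).tail ⟨⟨e, he⟩, trivial, ?_⟩
        simpa [H, Subtype.ext_iff] using hj
    · intro P hP hP'
      obtain ⟨p, hp⟩ := hP
      obtain ⟨q, hq⟩ := (Set.ne_univ_iff_exists_notMem _).1 hP'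
      have h := hcut (S.filter fun v => ∃ h, (⟨v, h⟩ : S) ∈ P)
        (S.filter fun v => ∃ h, (⟨v, h⟩ : S) ∉ P) ⟨p, by simp [hp]⟩ ⟨q, by simp [hq]⟩
        (Finset.disjoint_left.2 fun v hv hv' => by
          obtain ⟨-, h, hv⟩ := Finset.mem_filter.1 hv
          obtain ⟨-, h', hv'⟩ := Finset.mem_filter.1 hv'
          exact hv' hv)
        (by ext v; simp only [Finset.mem_union, Finset.mem_filter]
            constructor
            · tauto
            · intro h
              by_cases hv : (⟨v, h⟩ : S) ∈ P
              exacts [.inl ⟨h, h, hv⟩, .inr ⟨h, h, hv⟩])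
      refine h.trans ?_
      rw [← Set.ncard_image_of_injective _ Subtype.val_injective, ← Set.ncard_coe_finset]
      refine Set.ncard_le_ncard ?_ (Set.toFinite _)
      intro e he
      obtain ⟨heF, he⟩ := mem_between.1 he
      refine ⟨⟨e, heF⟩, ?_, rfl⟩
      simp only [Finset.mem_filter] at he
      rcases he with ⟨⟨_, _, h⟩, ⟨_, _, h'⟩⟩ | ⟨⟨_, _, h⟩, ⟨_, _, h'⟩⟩
      exacts [.inl ⟨h, h'⟩, .inr ⟨h, h'⟩]
  intro g hg
  obtain ⟨o, ho⟩ := hyp S F H hH (fun v => g v) (by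
    rw [Nat.card_eq_fintype_card, Fintype.card_coe, hg, Finset.sum_coe_sort S g])
  refine ⟨fun e => if h : e ∈ F then H.tail o ⟨e, h⟩ else G.fst e, fun e he => ?_, fun v hv => ?_⟩
  · simp only [he, dif_pos, tail, H]
    split_ifs <;> simp
  · rw [← show _ = g v from ho ⟨v, hv⟩, outDeg, outDegOn, tailCount, ← Finset.sum_coe_sort,
      Set.ncard_eq_toFinset_card',
      Finset.card_eq_sum_ones, Nat.cast_sum]
    simp only [Set.mem_univ, true_and, Set.toFinset_ofPred, Finset.sum_filter, Nat.cast_one]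
    refine Finset.sum_congr rfl fun e _ => ?_
    simp [Subtype.ext_iff]

theorem exists_card_eq_of_sum_le {m : ℕ} {f : Fin m → ℕ} (hpos : ∀ i, 1 ≤ f i)
    (hsum : ∑ i, f i ≤ m + 1) : (∀ i, f i = 1) ∨ ∃ j, f j = 2 ∧ (∀ i, i ≠ j → f i = 1) ∧
      ∑ i, f i = m + 1 := by
  by_cases h : ∀ i, f i = 1
  · exact .inl h
  push Not at h
  obtain ⟨j, hj⟩ := h
  have h1 : ∑ i, f i = ∑ i, (f i - 1) + m := by
    have : ∀ i, f i = (f i - 1) + 1 := fun i => by have := hpos i; omega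
    conv_lhs => rw [Finset.sum_congr rfl fun i _ => this i]
    simp [Finset.sum_add_distrib]
  have h2 := Finset.add_sum_erase Finset.univ (fun i => f i - 1) (Finset.mem_univ j)
  have h3 := hpos j
  refine .inr ⟨j, by omega, fun i hi => ?_, by omega⟩
  have h4 := Finset.single_le_sum (f := fun i => f i - 1) (fun _ _ => Nat.zero_le _)
    (Finset.mem_erase.2 ⟨hi, Finset.mem_univ i⟩)
  have := hpos i
  omega

theorem HasConnectedPacking.orientable {k lam : ℕ} (hk : 0 < k) (hlam : k + 2 ≤ lam)
    (hyp : ∀ (W F : Type) [Fintype W] [Fintype F] (H : Multigraph W F),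
      H.EdgeConnected lam →
        ∀ g : W → ZMod k, (Nat.card F : ZMod k) = ∑ w, g w →
          ∃ o : F → Bool, H.IsModOrientation k g o) (S : Finset V) :
    ∀ (G : Multigraph V E) (F : Finset E), (∀ e ∈ F, G.fst e ∈ S ∧ G.snd e ∈ S) →
      G.HasConnectedPacking S F (lam - 2) → G.Orientable k S F := by
  induction S using Finset.strongInduction with
  | H S ih =>
  rintro G F hF ⟨T, hTF, hdis, hconn⟩
  by_cases hcut : ∀ X Y, X.Nonempty → Y.Nonempty → Disjoint X Y → X ∪ Y = S →
      lam ≤ (G.between F X Y).card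
  · refine Orientable.of_forall_le_card_between hyp hF (fun u hu v hv => ?_) hcut
    refine Relation.ReflTransGen.mono ?_ _ _ (hconn ⟨0, by omega⟩ u hu v hv)
    rintro a b ⟨e, he, hj⟩
    exact ⟨e, hTF _ he, hj⟩
  push Not at hcut
  obtain ⟨X, Y, hX, hY, hXY, rfl, hlt⟩ := hcut
  have hTe : ∀ i, ∀ e ∈ T i, G.fst e ∈ X ∪ Y ∧ G.snd e ∈ X ∪ Y := fun i e he => hF e (hTF i he)
  have hXs : X ⊂ X ∪ Y := by
    refine Finset.ssubset_iff_subset_ne.2 ⟨Finset.subset_union_left, fun h => ?_⟩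
    obtain ⟨y, hy⟩ := hY
    exact Finset.disjoint_right.1 hXY hy (h ▸ Finset.mem_union_right _ hy)
  have hYs : Y ⊂ X ∪ Y := by
    refine Finset.ssubset_iff_subset_ne.2 ⟨Finset.subset_union_right, fun h => ?_⟩
    obtain ⟨x, hx⟩ := hX
    exact Finset.disjoint_left.1 hXY hx (h ▸ Finset.mem_union_left _ hx)
  have hsum : ∑ i, (G.between (T i) X Y).card ≤ (G.between F X Y).card := by
    rw [← Finset.card_biUnion]
    · refine Finset.card_le_card fun e he => ?_
      obtain ⟨i, -, he⟩ := Finset.mem_biUnion.1 he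
      exact mem_between.2 ⟨hTF i (mem_between.1 he).1, (mem_between.1 he).2⟩
    · intro i _ j _ hij
      exact Finset.disjoint_left.2 fun e h h' =>
        Finset.disjoint_left.1 (hdis i j hij) (mem_between.1 h).1 (mem_between.1 h').1
  have hpos : ∀ i, 1 ≤ (G.between (T i) X Y).card := fun i =>
    Finset.card_pos.2 ((hconn i).between_nonempty hX hY hXY (hTe i))
  have hsingleX : ∀ i, (G.between (T i) X Y).card = 1 → G.Connects (G.inner (T i) X) X := by
    intro i hi
    obtain ⟨c, hc⟩ := Finset.card_eq_one.1 hi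
    exact (hconn i).inner_of_between_eq_singleton hXY (hTe i) hc
  have hsingleY : ∀ i, (G.between (T i) X Y).card = 1 → G.Connects (G.inner (T i) Y) Y := by
    intro i hi
    obtain ⟨c, hc⟩ := Finset.card_eq_one.1 hi
    rw [between_comm] at hc
    exact Connects.inner_of_between_eq_singleton hXY.symm (Finset.union_comm X Y ▸ hTe i)
      (Finset.union_comm X Y ▸ hconn i) hc
  have hoX : (∀ i, G.Connects (G.inner (T i) X) X) → G.Orientable k X (G.inner F X) := fun h =>
    ih X hXs G _ (fun e he => (mem_inner.1 he).2) (hasConnectedPacking_inner hTF hdis h)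
  have hoY : (∀ i, G.Connects (G.inner (T i) Y) Y) → G.Orientable k Y (G.inner F Y) := fun h =>
    ih Y hYs G _ (fun e he => (mem_inner.1 he).2) (hasConnectedPacking_inner hTF hdis h)
  rcases exists_card_eq_of_sum_le hpos (by omega) with hone | ⟨j, hj, hone, hsum'⟩
  · have hsum' : lam - 2 ≤ (G.between F X Y).card := by
      simpa [hone] using hsum
    exact ((hoX fun i => hsingleX i (hone i)).freelyOrientable_between hk hXY
      (by omega)).orientable hXY hF (hoY fun i => hsingleY i (hone i))
  · obtain ⟨e₁, e₂, hne, he⟩ := Finset.card_eq_two.1 hj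
    rcases (hconn j).inner_or_inner_of_between_eq_pair hXY (hTe j) he with h | h
    · rw [Finset.union_comm X Y] at hF hconn ⊢
      rw [between_comm] at he
      refine (freelyOrientable_of_between_eq_pair hk hXY.symm hF hTF hdis hconn hne he
        (fun i hi => hsingleY i (hone i hi)) (ih Y hYs) ?_).orientable hXY.symm hF
        (hoX fun i => ?_)
      · rw [between_comm]; omega
      · by_cases hi : i = j
        exacts [hi ▸ h, hsingleX i (hone i hi)]
    · refine (freelyOrientable_of_between_eq_pair hk hXY hF hTF hdis hconn hne he
        (fun i hi => hsingleX i (hone i hi)) (ih X hXs) (by omega)).orientable hXY hF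
        (hoY fun i => ?_)
      by_cases hi : i = j
      exacts [hi ▸ h, hsingleY i (hone i hi)]

end TwoParts

end Multigraph

/-- let `k ≥ 3`, `r ≥ 0`, and `λ ≥ k + 2` be such that every
`λ`-edge-connected graph `H` admits a `g`-orientation for every `g` with
`|E(H)| ≡ ∑ g (mod k)`. If `G` is a bipartite graph with parts `A₁`, `A₂`
containing `2r + λ - 2` pairwise edge-disjoint spanning trees and `k ∣ |E(G)|`,
then `E(G)` can be partitioned into `E₁` and `E₂` such that each spanning
subgraph `G_i = (V, E_i)` contains `r` pairwise edge-disjoint spanning trees and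
the degree in `G_i` of every vertex of `A_i` is divisible by `k`. -/
theorem bipartite_decomposition_of_edge_disjoint_spanning_trees
    (k r lam : ℕ) (hk : 3 ≤ k) (hlam : k + 2 ≤ lam)
    (hyp : ∀ (W F : Type) [Fintype W] [Fintype F] (H : Multigraph W F),
      H.EdgeConnected lam →
        ∀ g : W → ZMod k, (Nat.card F : ZMod k) = ∑ w, g w →
          ∃ o : F → Bool, H.IsModOrientation k g o)
    {V E : Type} [Fintype V] [Fintype E] (G : Multigraph V E)
    (A₁ A₂ : Set V) (hdisj : Disjoint A₁ A₂) (hcover : A₁ ∪ A₂ = Set.univ)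
    (hbip : ∀ e, (G.fst e ∈ A₁ ∧ G.snd e ∈ A₂) ∨ (G.fst e ∈ A₂ ∧ G.snd e ∈ A₁))
    (htrees : G.HasEdgeDisjointSpanningTrees (2 * r + lam - 2))
    (hdvd : k ∣ Nat.card E) :
    ∃ E₁ E₂ : Set E, Disjoint E₁ E₂ ∧ E₁ ∪ E₂ = Set.univ ∧
      (∃ T : Fin r → Set E, (∀ i, T i ⊆ E₁ ∧ G.IsSpanningTree (T i)) ∧
        ∀ i j, i ≠ j → Disjoint (T i) (T j)) ∧
      (∃ T : Fin r → Set E, (∀ i, T i ⊆ E₂ ∧ G.IsSpanningTree (T i)) ∧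
        ∀ i j, i ≠ j → Disjoint (T i) (T j)) ∧
      (∀ v ∈ A₁, k ∣ G.degOn E₁ v) ∧ (∀ v ∈ A₂, k ∣ G.degOn E₂ v) := by
  classical
  obtain ⟨T, hT, hTdis⟩ := htrees
  let T₁ : Fin r → Set E := fun i => T ⟨i, by omega⟩
  let T₂ : Fin r → Set E := fun i => T ⟨r + i, by omega⟩
  let T₃ : Fin (lam - 2) → Set E := fun i => T ⟨2 * r + i, by omega⟩
  let P₁ : Finset E := Finset.univ.filter fun e => ∃ i, e ∈ T₁ i
  let P₂ : Finset E := Finset.univ.filter fun e => ∃ i, e ∈ T₂ i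
  have hP : Disjoint P₁ P₂ := by
    refine Finset.disjoint_left.2 fun e h h' => ?_
    obtain ⟨-, i, hi⟩ := Finset.mem_filter.1 h
    obtain ⟨-, j, hj⟩ := Finset.mem_filter.1 h'
    exact Set.disjoint_left.1 (hTdis _ _ (by simp only [ne_eq, Fin.mk.injEq]; omega)) hi hj
  have hends : ∀ e, ∃ a ∈ A₁, ∃ b ∈ A₂, G.Joins e a b := fun e => by
    rcases hbip e with h | h
    exacts [⟨_, h.1, _, h.2, .inl ⟨rfl, rfl⟩⟩, ⟨_, h.2, _, h.1, .inr ⟨rfl, rfl⟩⟩]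
  choose a ha b hb hj using hends
  have hA : ∀ v, v ∈ A₁ → v ∉ A₂ := fun v h h' => Set.disjoint_left.1 hdisj h h'
  let s : E → V := fun e => if e ∈ P₁ then a e else b e
  have hs : G.IsTailMap (P₁ ∪ P₂) s := fun e _ => by
    by_cases h : e ∈ P₁ <;> rcases hj e with ⟨h1, h2⟩ | ⟨h1, h2⟩ <;> simp [s, h, h1, h2]
  have hmemU : ∀ v : V, v ∈ (Finset.univ : Finset V) := Finset.mem_univ
  have hpack : G.HasConnectedPacking Finset.univ (P₁ ∪ P₂)ᶜ (lam - 2) := by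
    refine ⟨fun i => (T₃ i).toFinset, fun i e he => ?_, fun i j hij => ?_, fun i u _ v _ => ?_⟩
    · have he : e ∈ T₃ i := by simpa using he
      simp only [Finset.mem_compl, Finset.mem_union, not_or, P₁, P₂, Finset.mem_filter,
        Finset.mem_univ, true_and, not_exists]
      constructor <;> intro j hj <;>
        exact Set.disjoint_left.1 (hTdis _ _ (by simp only [ne_eq, Fin.mk.injEq]; omega)) hj he
    · rw [Set.disjoint_toFinset]
      exact hTdis _ _ (by simp only [ne_eq, Fin.mk.injEq]; omega)
    · rw [Set.coe_toFinset]
      exact (hT _).1.2 u trivial v trivial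
  have hsum := hs.sum_tailCount (k := k) (S := Finset.univ) (fun e _ => ⟨hmemU _, hmemU _⟩)
  obtain ⟨t, ht, htg⟩ := hpack.orientable (by omega) hlam hyp Finset.univ G _
    (fun e _ => ⟨hmemU _, hmemU _⟩) (fun v => - Multigraph.tailCount k (P₁ ∪ P₂) s v) (by
      have hE : ((P₁ ∪ P₂).card : ZMod k) + ((P₁ ∪ P₂)ᶜ.card : ZMod k) = 0 := by
        rw [← Nat.cast_add, Finset.card_add_card_compl, ← Nat.card_eq_fintype_card]
        exact (ZMod.natCast_eq_zero_iff _ _).2 hdvd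
      rw [Finset.sum_neg_distrib, hsum]
      linear_combination hE)
  let w : E → V := fun e => if e ∈ P₁ ∪ P₂ then s e else t e
  have hU : (P₁ ∪ P₂) ∪ (P₁ ∪ P₂)ᶜ = Finset.univ := Finset.union_compl _
  have hw : G.IsTailMap Finset.univ w := by
    simpa only [hU] using hs.piecewise ht
  have hw0 : ∀ v, k ∣ (Finset.univ.filter fun e => w e = v).card := fun v => by
    have h := Multigraph.tailCount_piecewise (k := k) (A := P₁ ∪ P₂) (B := (P₁ ∪ P₂)ᶜ)
      disjoint_compl_right s t v
    rw [htg v (hmemU v), add_neg_cancel, hU] at h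
    rw [← ZMod.natCast_eq_zero_iff, ← h, Multigraph.tailCount]
    simp only [Finset.sum_boole, w]
  have hwab : ∀ e, w e = a e ∨ w e = b e := fun e => by
    rcases hj e with ⟨h1, h2⟩ | ⟨h1, h2⟩ <;> rcases hw e (by simp) with h | h <;> simp [h, h1, h2]
  have hinc : ∀ e v, (G.fst e = v ∨ G.snd e = v) ↔ (a e = v ∨ b e = v) := fun e v => by
    rcases hj e with ⟨h1, h2⟩ | ⟨h1, h2⟩ <;> rw [h1, h2]
    exact or_comm
  have hcount : ∀ (A : Set V) v, (∀ e, (w e ∈ A ∧ (a e = v ∨ b e = v)) ↔ w e = v) →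
      k ∣ G.degOn {e | w e ∈ A} v := fun A v h => by
    have h0 := hw0 v
    rw [← Set.ncard_coe_finset] at h0
    rw [Multigraph.degOn]
    convert h0 using 2
    ext e
    simp only [Set.mem_ofPred_eq, hinc, h, Finset.coe_filter, Finset.mem_univ, true_and]
  refine ⟨{e | w e ∈ A₁}, {e | w e ∈ A₂}, ?_, ?_, ⟨T₁, ?_, ?_⟩, ⟨T₂, ?_, ?_⟩, ?_, ?_⟩
  · exact Set.disjoint_left.2 fun e h h' => hA _ h h'
  · ext e
    have : w e ∈ A₁ ∪ A₂ := hcover ▸ trivial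
    simpa using this
  · refine fun i => ⟨fun e he => ?_, hT _⟩
    have he : e ∈ P₁ := Finset.mem_filter.2 ⟨Finset.mem_univ e, i, he⟩
    simpa [w, s, he] using ha e
  · exact fun i j hij => hTdis _ _ (by simp only [ne_eq, Fin.mk.injEq]; omega)
  · refine fun i => ⟨fun e he => ?_, hT _⟩
    have he : e ∈ P₂ := Finset.mem_filter.2 ⟨Finset.mem_univ e, i, he⟩
    have he' : e ∉ P₁ := Finset.disjoint_right.1 hP he
    simpa [w, s, he, he'] using hb e
  · exact fun i j hij => hTdis _ _ (by simp only [ne_eq, Fin.mk.injEq]; omega)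
  · refine fun v hv => hcount A₁ v fun e => ⟨fun ⟨h, h'⟩ => ?_, ?_⟩
    · have hwa : w e = a e := (hwab e).resolve_right fun h'' => hA _ h (h'' ▸ hb e)
      exact hwa.trans (h'.resolve_right fun h'' => hA _ hv (h'' ▸ hb e))
    · rintro rfl
      exact ⟨hv, (hwab e).imp Eq.symm Eq.symm⟩
  · refine fun v hv => hcount A₂ v fun e => ⟨fun ⟨h, h'⟩ => ?_, ?_⟩
    · have hwb : w e = b e := (hwab e).resolve_left fun h'' => hA _ (h'' ▸ ha e) h
      exact hwb.trans (h'.resolve_left fun h'' => hA _ (h'' ▸ ha e) hv)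
    · rintro rfl
      exact ⟨hv, (hwab e).imp Eq.symm Eq.symm⟩
end
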